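/- Let C_Δ be the class of unit disk graphs whose maximum vertex degree is at most Δ. Then C_Δ has truly sublinear treewidth with parameter λ = 1/2; concretely, for every η > 0 there is β > 0 (one may take β = 200Δ³(η+1)) such that for every G ∈ C_Δ and X ⊆ V(G), tw(G ∖ X) ≤ η implies tw(G) ≤ η + β·|X|^{1/2}. -/

import Mathlib

open SimpleGraph Set Metric

/-- `G` has a tree decomposition of width at most `k`. -/
def SimpleGraph.TreewidthLE {V : Type} (G : SimpleGraph V) (k : ℕ) : Prop :=
  ∃ (ι : Type) (T : SimpleGraph ι) (bag : ι → Set V),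
    T.IsTree ∧
    (∀ v : V, ∃ i, v ∈ bag i) ∧
    (∀ u w : V, G.Adj u w → ∃ i, u ∈ bag i ∧ w ∈ bag i) ∧
    (∀ v : V, (T.induce {i | v ∈ bag i}).Connected) ∧
    (∀ i, (bag i).Finite ∧ (bag i).ncard ≤ k + 1)

/-- The treewidth of a graph: the least width of a tree decomposition. -/
noncomputable def SimpleGraph.treewidth {V : Type} (G : SimpleGraph V) : ℕ :=
  sInf {k | G.TreewidthLE k}

/-- The Euclidean plane. -/
abbrev Plane : Type := EuclideanSpace ℝ (Fin 2)

/-- `c` assigns to the vertices of `G` centers of closed unit disks realizing `G` as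
their intersection graph: two distinct vertices are adjacent iff the corresponding unit
disks intersect, i.e. iff their centers are at distance at most `2`. -/
def IsUnitDiskRealization {V : Type} (G : SimpleGraph V) (c : V → Plane) : Prop :=
  ∀ u v : V, G.Adj u v ↔ u ≠ v ∧ dist (c u) (c v) ≤ 2

/-- `G` is a unit disk graph. -/
def IsUnitDiskGraph {V : Type} (G : SimpleGraph V) : Prop :=
  ∃ c : V → Plane, IsUnitDiskRealization G c

/-- A class of graphs has truly sublinear treewidth with parameter `lam ∈ (0,1)` if for
every `η > 0` there exists `β > 0` such that for every graph `G` in the class and every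
vertex set `X`, `tw(G ∖ X) ≤ η` implies `tw(G) ≤ η + β·|X|^lam`. -/
def HasTrulySublinearTreewidth (C : ∀ V : Type, SimpleGraph V → Prop) (lam : ℝ) : Prop :=
  ∀ η : ℕ, 0 < η → ∃ β : ℝ, 0 < β ∧
    ∀ (V : Type) [Fintype V] (G : SimpleGraph V), C V G →
      ∀ X : Set V, (G.induce Xᶜ).treewidth ≤ η →
        (G.treewidth : ℝ) ≤ (η : ℝ) + β * (X.ncard : ℝ) ^ lam

namespace SimpleGraph

variable {V : Type}

/-- `S` is nonempty and cannot be split into two parts without an edge between them. -/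
def ConnOn (G : SimpleGraph V) (S : Set V) : Prop :=
  S.Nonempty ∧ ∀ D : Set V, (D ∩ S).Nonempty →
    (∀ a ∈ D ∩ S, ∀ b ∈ S, G.Adj a b → b ∈ D) → S ⊆ D

namespace ConnOn

variable {G : SimpleGraph V} {S A B W : Set V}

theorem of_base {t : V} (ht : t ∈ S)
    (h : ∀ D : Set V, t ∈ D → (∀ a ∈ D ∩ S, ∀ b ∈ S, G.Adj a b → b ∈ D) → S ⊆ D) :
    G.ConnOn S := by
  refine ⟨⟨t, ht⟩, fun D ⟨x, hxD, hxS⟩ hD => ?_⟩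
  by_cases htD : t ∈ D
  · exact h D htD hD
  · refine absurd hxD (h Dᶜ htD ?_ hxS)
    exact fun a ha b hb hab hbD => ha.1 (hD b ⟨hbD, hb⟩ a ha.2 hab.symm)

theorem singleton (G : SimpleGraph V) (v : V) : G.ConnOn {v} :=
  of_base (mem_singleton v) fun _ hv _ => by simpa using hv

theorem sUnion {F : Set (Set V)} {t : V} (hF : F.Nonempty) (ht : ∀ C ∈ F, t ∈ C)
    (h : ∀ C ∈ F, G.ConnOn C) : G.ConnOn (⋃₀ F) := by
  obtain ⟨C₀, hC₀⟩ := hF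
  refine of_base (t := t) ⟨C₀, hC₀, ht _ hC₀⟩ fun D htD hD => ?_
  refine sUnion_subset fun C hC => (h C hC).2 D ⟨t, htD, ht C hC⟩ ?_
  exact fun a ha b hb hab => hD a ⟨ha.1, C, hC, ha.2⟩ b ⟨C, hC, hb⟩ hab

theorem union_of_adj (hA : G.ConnOn A) (hB : G.ConnOn B) {a b : V} (ha : a ∈ A) (hb : b ∈ B)
    (hab : G.Adj a b) : G.ConnOn (A ∪ B) := by
  refine of_base (t := a) (Or.inl ha) fun D haD hD => ?_
  have hAD : A ⊆ D := hA.2 D ⟨a, haD, ha⟩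
    fun x hx y hy => hD x ⟨hx.1, Or.inl hx.2⟩ y (Or.inl hy)
  have hbD : b ∈ D := hD a ⟨haD, Or.inl ha⟩ b (Or.inr hb) hab
  exact union_subset hAD (hB.2 D ⟨b, hbD, hb⟩
    fun x hx y hy => hD x ⟨hx.1, Or.inr hx.2⟩ y (Or.inr hy))

theorem insert (hA : G.ConnOn A) {a b : V} (ha : a ∈ A) (hab : G.Adj a b) :
    G.ConnOn (insert b A) := by
  rw [← union_singleton]
  exact hA.union_of_adj (singleton G b) ha rfl hab

/-- A connected set avoiding `S` extends to a connected set all of whose exits lie in `S`. -/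
theorem exists_maximal (hW : G.ConnOn W) (hWS : Disjoint W S) :
    ∃ B, W ⊆ B ∧ G.ConnOn B ∧ Disjoint B S ∧ ∀ b ∈ B, ∀ w, G.Adj b w → w ∉ B → w ∈ S := by
  obtain ⟨t, ht⟩ := hW.1
  let F : Set (Set V) := {C | G.ConnOn C ∧ W ⊆ C ∧ Disjoint C S}
  have hWF : W ∈ F := ⟨hW, Subset.rfl, hWS⟩
  refine ⟨⋃₀ F, subset_sUnion_of_mem hWF, sUnion (t := t) ⟨W, hWF⟩ (fun C hC => hC.2.1 ht)
    (fun C hC => hC.1), disjoint_sUnion_left.2 fun C hC => hC.2.2, ?_⟩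
  rintro b ⟨C, hC, hbC⟩ w hbw hw
  by_contra hwS
  refine hw ⟨Insert.insert w C, ⟨hC.1.insert hbC hbw, hC.2.1.trans (subset_insert _ _), ?_⟩,
    mem_insert _ _⟩
  rw [disjoint_insert_left]
  exact ⟨hwS, hC.2.2⟩

theorem subset_of_exits (hW : G.ConnOn W) (hWB : (W ∩ B).Nonempty)
    (hB : ∀ b ∈ B, ∀ w, G.Adj b w → w ∉ B → w ∈ S) (hWS : Disjoint W S) : W ⊆ B := by
  refine hW.2 B (by rwa [inter_comm]) fun a ha b hb hab => ?_
  by_contra hbB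
  exact Set.disjoint_left.1 hWS hb (hB a ha.1 b hab hbB)

theorem exists_walk (hS : G.ConnOn S) {u v : V} (hu : u ∈ S) (hv : v ∈ S) :
    ∃ p : G.Walk u v, ∀ x ∈ p.support, x ∈ S := by
  refine hS.2 {x | ∃ p : G.Walk u x, ∀ y ∈ p.support, y ∈ S} ⟨u, ⟨.nil, by simpa⟩, hu⟩ ?_ hv
  rintro a ⟨⟨p, hp⟩, -⟩ b hb hab
  refine ⟨p.concat hab, fun y hy => ?_⟩
  simp only [Walk.support_concat, List.mem_append, List.mem_singleton] at hy
  rcases hy with hy | rfl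
  exacts [hp y hy, hb]

theorem image_induce {W : Set S} (hW : (G.induce S).ConnOn W) : G.ConnOn ((↑) '' W) := by
  obtain ⟨t, ht⟩ := hW.1
  refine of_base (t := t) ⟨t, ht, rfl⟩ fun D htD hD => ?_
  rw [image_subset_iff]
  refine hW.2 _ ⟨t, htD, ht⟩ fun a ha b hb hab => ?_
  exact hD a ⟨ha.1, a, ha.2, rfl⟩ b ⟨b, hb, rfl⟩ hab

/-- A connected set with at least two points has no isolated point. -/
theorem exists_adj (hS : G.ConnOn S) {u v : V} (hu : u ∈ S) (hv : v ∈ S) (huv : u ≠ v) :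
    ∃ w ∈ S, G.Adj u w := by
  by_contra! h
  refine huv (hS.2 {u} ⟨u, rfl, hu⟩ ?_ hv).symm
  rintro a ⟨rfl, -⟩ b hb hab
  exact absurd hab (h b hb)

end ConnOn
end SimpleGraph

namespace SimpleGraph

theorem IsAcyclic.sum {α β : Type*} {G : SimpleGraph α} {H : SimpleGraph β}
    (hG : G.IsAcyclic) (hH : H.IsAcyclic) : (G ⊕g H).IsAcyclic := by
  rw [isAcyclic_iff_forall_adj_isBridge] at *
  rintro (a | a) (b | b) hab
  · have h := hG (v := a) (w := b) (by simpa using hab)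
    rw [isBridge_iff] at h ⊢
    rintro ⟨p⟩
    refine h ?_
    suffices ∀ x y, ((G ⊕g H) \ fromEdgeSet {s(Sum.inl a, Sum.inl b)}).Walk x y →
        ∀ c, x = Sum.inl c → ∃ d, y = Sum.inl d ∧ (G \ fromEdgeSet {s(a, b)}).Reachable c d by
      obtain ⟨d, hd, hr⟩ := this _ _ p a rfl
      cases hd
      exact hr
    intro x y p
    induction p with
    | nil => exact fun c hc => ⟨c, hc, Reachable.refl c⟩
    | @cons x y z hxy p ih =>
      rintro c rfl
      rcases y with y | y
      · obtain ⟨d, hd, hr⟩ := ih y rfl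
        refine ⟨d, hd, Reachable.trans (Adj.reachable ?_) hr⟩
        simpa using hxy
      · simp at hxy
  · simp at hab
  · simp at hab
  · have h := hH (v := a) (w := b) (by simpa using hab)
    rw [isBridge_iff] at h ⊢
    rintro ⟨p⟩
    refine h ?_
    suffices ∀ x y, ((G ⊕g H) \ fromEdgeSet {s(Sum.inr a, Sum.inr b)}).Walk x y →
        ∀ c, x = Sum.inr c → ∃ d, y = Sum.inr d ∧ (H \ fromEdgeSet {s(a, b)}).Reachable c d by
      obtain ⟨d, hd, hr⟩ := this _ _ p a rfl
      cases hd
      exact hr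
    intro x y p
    induction p with
    | nil => exact fun c hc => ⟨c, hc, Reachable.refl c⟩
    | @cons x y z hxy p ih =>
      rintro c rfl
      rcases y with y | y
      · simp at hxy
      · obtain ⟨d, hd, hr⟩ := ih y rfl
        refine ⟨d, hd, Reachable.trans (Adj.reachable ?_) hr⟩
        simpa using hxy

theorem Connected.induce_image {α β : Type*} {G : SimpleGraph α} {H : SimpleGraph β}
    {s : Set α} (h : (G.induce s).Connected) (f : G →g H) : (H.induce (f '' s)).Connected := by
  let g : G.induce s →g H.induce (f '' s) :=
    { toFun := fun x => ⟨f x, x, x.2, rfl⟩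
      map_rel' := fun {a b} hab => f.map_adj (show G.Adj a b from hab) }
  refine h.map g ?_
  rintro ⟨_, x, hx, rfl⟩
  exact ⟨⟨x, hx⟩, rfl⟩

variable {V V' : Type}

theorem TreewidthLE.mono {G : SimpleGraph V} {k l : ℕ} (h : G.TreewidthLE k) (hkl : k ≤ l) :
    G.TreewidthLE l := by
  obtain ⟨ι, T, bag, h1, h2, h3, h4, h5⟩ := h
  exact ⟨ι, T, bag, h1, h2, h3, h4, fun i => ⟨(h5 i).1, (h5 i).2.trans (by lia)⟩⟩

theorem TreewidthLE.comap {G : SimpleGraph V} {G' : SimpleGraph V'} {k : ℕ}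
    (h : G.TreewidthLE k) (f : V' → V) (hf : f.Injective)
    (hadj : ∀ u w, G'.Adj u w → G.Adj (f u) (f w)) : G'.TreewidthLE k := by
  obtain ⟨ι, T, bag, h1, h2, h3, h4, h5⟩ := h
  refine ⟨ι, T, fun i => f ⁻¹' bag i, h1, fun v => h2 (f v), fun u w huw => h3 _ _ (hadj u w huw),
    fun v => h4 (f v), fun i => ⟨(h5 i).1.preimage hf.injOn, le_trans ?_ (h5 i).2⟩⟩
  exact ncard_le_ncard_of_injOn f (fun a ha => ha) hf.injOn (h5 i).1

theorem TreewidthLE.of_card [Finite V] {G : SimpleGraph V} {n : ℕ} (h : Nat.card V ≤ n + 1) :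
    G.TreewidthLE n := by
  refine ⟨Unit, ⊥, fun _ => Set.univ, IsTree.of_subsingleton, by simp, by simp, fun v => ?_,
    fun _ => ⟨Set.toFinite _, by rwa [ncard_univ]⟩⟩
  have : Nonempty {i : Unit | v ∈ (fun _ => (Set.univ : Set V)) i} := ⟨⟨(), by simp⟩⟩
  exact (IsTree.of_subsingleton).connected

theorem TreewidthLE.of_induce_compl {G : SimpleGraph V} {S : Set V} {k n : ℕ}
    (h : (G.induce Sᶜ).TreewidthLE k) (hS : S.Finite) (hn : S.ncard ≤ n) :
    G.TreewidthLE (k + n) := by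
  obtain ⟨ι, T, bag, h1, h2, h3, h4, h5⟩ := h
  obtain ⟨i₀⟩ := h1.connected.nonempty
  have key : ∀ v (hv : v ∉ S) i, v ∈ S ∪ (↑) '' bag i ↔ (⟨v, hv⟩ : (Sᶜ : Set V)) ∈ bag i := by
    intro v hv i
    simp only [mem_union, hv, false_or, mem_image, Subtype.exists, exists_and_right,
      exists_eq_right]
    exact ⟨fun ⟨_, h⟩ => h, fun h => ⟨hv, h⟩⟩
  refine ⟨ι, T, fun i => S ∪ (↑) '' bag i, h1, fun v => ?_, fun u w huw => ?_, fun v => ?_,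
    fun i => ⟨hS.union ((h5 i).1.image _), ?_⟩⟩
  · by_cases hv : v ∈ S
    · exact ⟨i₀, Or.inl hv⟩
    · obtain ⟨i, hi⟩ := h2 ⟨v, hv⟩
      exact ⟨i, (key v hv i).2 hi⟩
  · by_cases hu : u ∈ S
    · by_cases hw : w ∈ S
      · exact ⟨i₀, Or.inl hu, Or.inl hw⟩
      · obtain ⟨i, hi⟩ := h2 ⟨w, hw⟩
        exact ⟨i, Or.inl hu, (key w hw i).2 hi⟩
    · by_cases hw : w ∈ S
      · obtain ⟨i, hi⟩ := h2 ⟨u, hu⟩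
        exact ⟨i, (key u hu i).2 hi, Or.inl hw⟩
      · obtain ⟨i, hi, hi'⟩ := h3 ⟨u, hu⟩ ⟨w, hw⟩ huw
        exact ⟨i, (key u hu i).2 hi, (key w hw i).2 hi'⟩
  · by_cases hv : v ∈ S
    · have : {i | v ∈ S ∪ (↑) '' bag i} = Set.univ := by
        ext i; simp [hv]
      rw [this]
      exact (induceUnivIso T).connected_iff.2 h1.connected
    · have : {i | v ∈ S ∪ (↑) '' bag i} = {i | (⟨v, hv⟩ : (Sᶜ : Set V)) ∈ bag i} := by
        ext i; exact key v hv i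
      rw [this]
      exact h4 _
  · refine (ncard_union_le _ _).trans ?_
    have := ncard_image_le (f := ((↑) : (Sᶜ : Set V) → V)) (h5 i).1
    have := (h5 i).2
    lia

theorem TreewidthLE.of_induce_of_induce_compl {G : SimpleGraph V} {A : Set V} {k : ℕ}
    (hA : (G.induce A).TreewidthLE k) (hA' : (G.induce Aᶜ).TreewidthLE k)
    (hno : ∀ a ∈ A, ∀ b, G.Adj a b → b ∈ A) : G.TreewidthLE k := by
  obtain ⟨ι, T, bag, h1, h2, h3, h4, h5⟩ := hA
  obtain ⟨ι', T', bag', h1', h2', h3', h4', h5'⟩ := hA'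
  obtain ⟨i₀⟩ := h1.connected.nonempty
  obtain ⟨j₀⟩ := h1'.connected.nonempty
  let T₁ : SimpleGraph (ι ⊕ ι') := (T ⊕g T') ⊔ edge (Sum.inl i₀) (Sum.inr j₀)
  have hT₁ : T₁.IsTree := by
    refine ⟨h1.connected.sum_sup_edge h1'.connected, ?_⟩
    exact (h1.isAcyclic.sum h1'.isAcyclic).sup_edge_of_not_reachable (not_reachable_sum_inl_inr _ _)
  let f : T →g T₁ := ⟨Sum.inl, fun {a b} h => Or.inl (by simpa using h)⟩
  let f' : T' →g T₁ := ⟨Sum.inr, fun {a b} h => Or.inl (by simpa using h)⟩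
  let b : ι ⊕ ι' → Set V := Sum.elim (fun i => (↑) '' bag i) (fun i => (↑) '' bag' i)
  refine ⟨ι ⊕ ι', T₁, b, hT₁, fun v => ?_, fun u w huw => ?_, fun v => ?_, ?_⟩
  · by_cases hv : v ∈ A
    · obtain ⟨i, hi⟩ := h2 ⟨v, hv⟩
      exact ⟨Sum.inl i, _, hi, rfl⟩
    · obtain ⟨i, hi⟩ := h2' ⟨v, hv⟩
      exact ⟨Sum.inr i, _, hi, rfl⟩
  · by_cases hu : u ∈ A
    · obtain ⟨i, hi, hi'⟩ := h3 ⟨u, hu⟩ ⟨w, hno u hu w huw⟩ huw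
      exact ⟨Sum.inl i, ⟨_, hi, rfl⟩, ⟨_, hi', rfl⟩⟩
    · have hw : w ∉ A := fun hw => hu (hno w hw u huw.symm)
      obtain ⟨i, hi, hi'⟩ := h3' ⟨u, hu⟩ ⟨w, hw⟩ huw
      exact ⟨Sum.inr i, ⟨_, hi, rfl⟩, ⟨_, hi', rfl⟩⟩
  · by_cases hv : v ∈ A
    · have : {i | v ∈ b i} = f '' {i | ⟨v, hv⟩ ∈ bag i} := by
        ext (i | i) <;> simp [b, f, hv]
      rw [this]
      exact (h4 _).induce_image f
    · have : {i | v ∈ b i} = f' '' {i | ⟨v, hv⟩ ∈ bag' i} := by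
        ext (i | i) <;> simp [b, f', hv]
      rw [this]
      exact (h4' _).induce_image f'
  · rintro (i | i)
    · exact ⟨(h5 i).1.image _, (ncard_image_le (h5 i).1).trans (h5 i).2⟩
    · exact ⟨(h5' i).1.image _, (ncard_image_le (h5' i).1).trans (h5' i).2⟩

theorem TreewidthLE.of_forall_connOn {k : ℕ} (n : ℕ) : ∀ (V : Type) [Finite V]
    (G : SimpleGraph V), Nat.card V = n → (∀ W, G.ConnOn W → (G.induce W).TreewidthLE k) →
    G.TreewidthLE k := by
  induction n using Nat.strong_induction_on with
  | _ n ih =>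
    intro V _ G hn hW
    rcases isEmpty_or_nonempty V with hV | ⟨⟨v⟩⟩
    · exact TreewidthLE.of_card (by simp)
    obtain ⟨B, hvB, hB, -, hexit⟩ := (ConnOn.singleton G v).exists_maximal (disjoint_empty _)
    have hno : ∀ a ∈ B, ∀ b, G.Adj a b → b ∈ B := fun a ha b hab => by
      by_contra hb
      exact hexit a ha b hab hb
    refine (hW B hB).of_induce_of_induce_compl (ih _ ?_ _ _ rfl fun W hWc => ?_) hno
    · rw [← hn, Nat.card_coe_set_eq, ← ncard_univ]
      refine ncard_lt_ncard ⟨subset_univ _, fun h => ?_⟩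
      exact h (mem_univ v) (hvB rfl)
    · refine (hW _ hWc.image_induce).comap (fun x => ⟨x.1.1, x.1, x.2, rfl⟩) ?_ ?_
      · intro x y hxy
        exact Subtype.ext (Subtype.ext (Subtype.mk.inj hxy))
      · exact fun _ _ h => h

theorem treewidthLE_treewidth [Finite V] (G : SimpleGraph V) : G.TreewidthLE G.treewidth :=
  Nat.sInf_mem (s := {k | G.TreewidthLE k}) ⟨Nat.card V, TreewidthLE.of_card (by lia)⟩

theorem TreewidthLE.treewidth_le {G : SimpleGraph V} {k : ℕ} (h : G.TreewidthLE k) :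
    G.treewidth ≤ k :=
  Nat.sInf_le h

end SimpleGraph

namespace SimpleGraph

section Median

variable {ι : Type*} {T : SimpleGraph ι}

theorem Walk.IsPath.append_of_forall {i b y : ι} {p : T.Walk i b} {q : T.Walk b y}
    (hp : p.IsPath) (hq : q.IsPath) (h : ∀ x ∈ p.support, x ∈ q.support → x = b) :
    (p.append q).IsPath := by
  rw [Walk.isPath_def, Walk.support_append]
  have hq' := (Walk.isPath_def q).1 hq
  rw [← Walk.cons_tail_support, List.nodup_cons] at hq'
  refine List.Nodup.append ((Walk.isPath_def p).1 hp) hq'.2 fun x hx hx' => ?_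
  obtain rfl := h x hx (List.mem_of_mem_tail hx')
  exact hq'.1 hx'

theorem IsTree.support_subset (hT : T.IsTree) {i j : ι} {p q : T.Walk i j} (hp : p.IsPath) :
    p.support ⊆ q.support := by
  classical
  have h : q.bypass = p := (hT.existsUnique_path i j).unique q.bypass_isPath hp
  rw [← h]
  exact q.support_bypass_subset_support

/-- In a tree any three nodes have a common separating node. -/
theorem IsTree.exists_median (hT : T.IsTree) (i j y : ι) :
    ∃ b, (∀ p : T.Walk i j, b ∈ p.support) ∧ (∀ p : T.Walk i y, b ∈ p.support) ∧
      ∀ p : T.Walk j y, b ∈ p.support := by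
  classical
  obtain ⟨P, hP, -⟩ := hT.existsUnique_path i j
  obtain ⟨b, hb, hmin⟩ := P.support.toFinset.exists_min_image (fun b => T.dist b y)
    ⟨i, by simp⟩
  rw [List.mem_toFinset] at hb
  obtain ⟨Q, hQ, hQl⟩ := hT.connected.exists_path_of_dist b y
  have hPQ : ∀ x ∈ P.support, x ∈ Q.support → x = b := by
    intro x hx hx'
    have h1 := hmin x (by simpa using hx)
    have h2 := dist_le (Q.dropUntil x hx')
    have h3 : (Q.takeUntil x hx').length + (Q.dropUntil x hx').length = Q.length := by
      rw [← Walk.length_append, Walk.take_spec]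
    exact (Walk.eq_of_length_eq_zero (p := Q.takeUntil x hx') (by lia)).symm
  have key : ∀ (k : ι) (R : T.Walk k b), R.IsPath → R.support ⊆ P.support →
      ∀ p : T.Walk k y, b ∈ p.support := by
    intro k R hR hRP p
    refine hT.support_subset (p := R.append Q) (hR.append_of_forall hQ ?_) ?_
    · exact fun x hx hx' => hPQ x (hRP hx) hx'
    · simp
  refine ⟨b, fun p => hT.support_subset hP hb,
    key i (P.takeUntil b hb) (hP.takeUntil hb) (P.support_takeUntil_subset_support hb),
    key j (P.dropUntil b hb).reverse (hP.dropUntil hb).reverse ?_⟩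
  rw [Walk.support_reverse]
  exact fun x hx => P.support_dropUntil_subset_support hb (List.mem_reverse.1 hx)

end Median

variable {V : Type}

/-- Any vertex set `Y` of a graph with a tree decomposition (outside `X`) with small bags can be
enlarged by a constant factor so that each connected set avoiding it and `X` has its marked
neighbours in two bags. -/
theorem exists_marking [Finite V] (H : SimpleGraph V) (X : Set V) {ι : Type*}
    {T : SimpleGraph ι} (hT : T.IsTree) (bag : ι → Set V) (e : ℕ)
    (hcov : ∀ v ∉ X, ∃ i, v ∈ bag i)
    (hadj : ∀ u ∉ X, ∀ w ∉ X, H.Adj u w → ∃ i, u ∈ bag i ∧ w ∈ bag i)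
    (hconn : ∀ v ∉ X, ∀ i j, v ∈ bag i → v ∈ bag j →
      ∃ p : T.Walk i j, ∀ x ∈ p.support, v ∈ bag x)
    (hcard : ∀ i, (bag i).ncard ≤ e) (Y : Set V) (hY : Disjoint Y X) :
    ∃ M, Y ⊆ M ∧ Disjoint M X ∧ M.ncard ≤ 2 * e * Y.ncard ∧
      ∀ C, H.ConnOn C → Disjoint C (X ∪ M) →
        ∃ i j, ∀ c ∈ C, ∀ w ∈ M, H.Adj c w → w ∈ bag i ∨ w ∈ bag j := by
  induction Y, Y.toFinite using Set.Finite.induction_on with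
  | empty =>
    obtain ⟨i⟩ := hT.connected.nonempty
    exact ⟨∅, by simp, by simp, by simp, fun C _ _ => ⟨i, i, by simp⟩⟩
  | @insert y Y hyY _ ih =>
    rw [disjoint_insert_left] at hY
    obtain ⟨M, hYM, hMX, hMc, hM⟩ := ih hY.2
    have hcardY : (insert y Y).ncard = Y.ncard + 1 := ncard_insert_of_notMem hyY
    by_cases hyM : y ∈ M
    · exact ⟨M, insert_subset hyM hYM, hMX, hMc.trans (by rw [hcardY]; gcongr; simp), hM⟩
    obtain ⟨B, hyB, hB, hBS, hexit⟩ := (ConnOn.singleton H y).exists_maximal (S := X ∪ M)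
      (by simpa using ⟨hY.1, hyM⟩)
    obtain ⟨i, j, hij⟩ := hM B hB hBS
    obtain ⟨k, hk⟩ := hcov y hY.1
    obtain ⟨b, hbij, hbik, hbjk⟩ := hT.exists_median i j k
    have hBX : ∀ x ∈ B, x ∉ X := fun x hx hxX => Set.disjoint_left.1 hBS hx (Or.inl hxX)
    refine ⟨M ∪ (bag b ∪ bag k) ∩ B, insert_subset (Or.inr ⟨Or.inr hk, hyB rfl⟩)
      (hYM.trans subset_union_left), ?_, ?_, fun C hC hCS => ?_⟩
    · rw [disjoint_union_left]
      exact ⟨hMX, Set.disjoint_left.2 fun x hx => hBX x hx.2⟩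
    · have h1 := ncard_union_le M ((bag b ∪ bag k) ∩ B)
      have h2 := ncard_le_ncard (inter_subset_left (s := bag b ∪ bag k) (t := B))
      have h3 := ncard_union_le (bag b) (bag k)
      have := hcard b
      have := hcard k
      rw [hcardY, mul_add]
      lia
    · have hCX : ∀ x ∈ C, x ∉ X := fun x hx h => Set.disjoint_left.1 hCS hx (Or.inl h)
      have hCM : ∀ x ∈ C, x ∉ M := fun x hx h => Set.disjoint_left.1 hCS hx (Or.inr (Or.inl h))
      have hCXM : Disjoint C (X ∪ M) :=
        hCS.mono_right (union_subset_union_right _ subset_union_left)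
      by_cases hCB : (C ∩ B).Nonempty
      · have hCsub : C ⊆ B := hC.subset_of_exits hCB hexit hCXM
        have hCb : ∀ x ∈ C, x ∉ bag b := fun x hx h =>
          Set.disjoint_left.1 hCS hx (Or.inr (Or.inr ⟨Or.inl h, hCsub hx⟩))
        obtain ⟨c₀, hc₀⟩ := hC.1
        obtain ⟨i₀, hi₀⟩ := hcov c₀ (hCX _ hc₀)
        have hreach : ∀ c ∈ C, ∀ l, c ∈ bag l → ∃ p : T.Walk i₀ l, b ∉ p.support := by
          intro c hc
          refine hC.2 {c | c ∈ C ∧ ∀ l, c ∈ bag l → ∃ p : T.Walk i₀ l, b ∉ p.support}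
            ⟨c₀, ⟨hc₀, fun l hl => ?_⟩, hc₀⟩ ?_ hc |>.2
          · obtain ⟨p, hp⟩ := hconn c₀ (hCX _ hc₀) _ _ hi₀ hl
            exact ⟨p, fun hb => hCb _ hc₀ (hp b hb)⟩
          · rintro a ⟨⟨-, ha⟩, haC⟩ a' ha' haa'
            refine ⟨ha', fun l hl => ?_⟩
            obtain ⟨l', hl', hl''⟩ := hadj a (hCX _ haC) a' (hCX _ ha') haa'
            obtain ⟨p, hp⟩ := ha l' hl'
            obtain ⟨p', hp'⟩ := hconn a' (hCX _ ha') _ _ hl'' hl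
            refine ⟨p.append p', fun hb => ?_⟩
            rcases (Walk.mem_support_append_iff _ _).1 hb with hb | hb
            exacts [hp hb, hCb _ ha' (hp' b hb)]
        have hreach' : ∀ c ∈ C, ∀ w ∉ X, H.Adj c w → w ∉ bag b → ∀ l, w ∈ bag l →
            ∃ p : T.Walk i₀ l, b ∉ p.support := by
          intro c hc w hw hcw hwb l hl
          obtain ⟨l', hl', hl''⟩ := hadj c (hCX _ hc) w hw hcw
          obtain ⟨p, hp⟩ := hreach c hc l' hl'
          obtain ⟨p', hp'⟩ := hconn w hw _ _ hl'' hl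
          refine ⟨p.append p', fun hb => ?_⟩
          rcases (Walk.mem_support_append_iff _ _).1 hb with hb | hb
          exacts [hp hb, hwb (hp' b hb)]
        have hmem : ∀ c ∈ C, ∀ w ∈ M ∪ (bag b ∪ bag k) ∩ B, H.Adj c w →
            w ∉ X ∧ (w ∈ bag b ∨ w ∈ bag i ∨ w ∈ bag j ∨ w ∈ bag k) := by
          rintro c hc w (hw | ⟨hw | hw, hwB⟩) hcw
          · refine ⟨fun h => Set.disjoint_left.1 hMX hw h, ?_⟩
            rcases hij c (hCsub hc) w hw hcw with h | h
            exacts [Or.inr (Or.inl h), Or.inr (Or.inr (Or.inl h))]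
          · exact ⟨hBX _ hwB, Or.inl hw⟩
          · exact ⟨hBX _ hwB, Or.inr (Or.inr (Or.inr hw))⟩
        have hno : ∀ {x x'}, (∀ p : T.Walk x x', b ∈ p.support) →
            (∃ p : T.Walk i₀ x, b ∉ p.support) → ¬ ∃ p : T.Walk i₀ x', b ∉ p.support := by
          rintro x x' h ⟨p, hp⟩ ⟨p', hp'⟩
          rcases (Walk.mem_support_append_iff _ _).1 (h (p.reverse.append p')) with hb | hb
          · exact hp (by simpa using hb)
          · exact hp' hb
        by_cases hi : ∃ p : T.Walk i₀ i, b ∉ p.support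
        · refine ⟨b, i, fun c hc w hw hcw => or_iff_not_imp_left.2 fun hwb => ?_⟩
          obtain ⟨hwX, h⟩ := hmem c hc w hw hcw
          have := hreach' c hc w hwX hcw hwb
          rcases h with h | h | h | h
          exacts [absurd h hwb, h, absurd (this _ h) (hno hbij hi), absurd (this _ h) (hno hbik hi)]
        by_cases hj : ∃ p : T.Walk i₀ j, b ∉ p.support
        · refine ⟨b, j, fun c hc w hw hcw => or_iff_not_imp_left.2 fun hwb => ?_⟩
          obtain ⟨hwX, h⟩ := hmem c hc w hw hcw
          have := hreach' c hc w hwX hcw hwb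
          rcases h with h | h | h | h
          exacts [absurd h hwb, absurd (this _ h) hi, h, absurd (this _ h) (hno hbjk hj)]
        · refine ⟨b, k, fun c hc w hw hcw => or_iff_not_imp_left.2 fun hwb => ?_⟩
          obtain ⟨hwX, h⟩ := hmem c hc w hw hcw
          have := hreach' c hc w hwX hcw hwb
          rcases h with h | h | h | h
          exacts [absurd h hwb, absurd (this _ h) hi, absurd (this _ h) hj, h]
      · obtain ⟨i', j', hij'⟩ := hM C hC hCXM
        refine ⟨i', j', ?_⟩
        rintro c hc w (hw | hw) hcw
        · exact hij' c hc w hw hcw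
        · by_cases hcB : c ∈ B
          · exact absurd ⟨c, hc, hcB⟩ hCB
          · exact absurd (hexit w hw.2 c hcw.symm hcB) (Set.disjoint_left.1 hCXM hc)

theorem exists_modulator [Finite V] (H : SimpleGraph V) (X : Set V) {η : ℕ}
    (h : (H.induce Xᶜ).TreewidthLE η) (Y : Set V) (hYX : Disjoint Y X)
    (hXY : ∀ x ∈ X, ∀ y, H.Adj x y → y ∈ X ∪ Y) :
    ∃ M, X ⊆ M ∧ Y ⊆ M ∧ M.ncard ≤ X.ncard + 2 * (η + 1) * Y.ncard ∧
      ∀ C, H.ConnOn C → Disjoint C M →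
        {w | w ∈ M ∧ ∃ c ∈ C, H.Adj c w}.ncard ≤ 2 * (η + 1) := by
  obtain ⟨ι, T, bag, h1, h2, h3, h4, h5⟩ := h
  have key : ∀ v (hv : v ∉ X) i, v ∈ ((↑) '' bag i : Set V) ↔
      (⟨v, hv⟩ : (Xᶜ : Set V)) ∈ bag i := by
    intro v hv i
    simp only [mem_image, Subtype.exists, exists_and_right, exists_eq_right]
    exact ⟨fun ⟨_, h⟩ => h, fun h => ⟨hv, h⟩⟩
  have hcard : ∀ i, ((↑) '' bag i : Set V).ncard ≤ η + 1 := fun i =>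
    (ncard_image_le (h5 i).1).trans (h5 i).2
  obtain ⟨M, hYM, hMX, hMc, hM⟩ := exists_marking H X h1 (fun i => (↑) '' bag i) (η + 1)
    (fun v hv => (h2 ⟨v, hv⟩).imp fun i hi => (key v hv i).2 hi)
    (fun u hu w hw huw => (h3 ⟨u, hu⟩ ⟨w, hw⟩ huw).imp
      fun i hi => ⟨(key u hu i).2 hi.1, (key w hw i).2 hi.2⟩)
    (fun v hv i j hi hj => by
      obtain ⟨p⟩ := (h4 ⟨v, hv⟩).preconnected ⟨i, (key v hv i).1 hi⟩ ⟨j, (key v hv j).1 hj⟩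
      refine ⟨p.map (Embedding.induce _).toHom, fun x hx => ?_⟩
      obtain ⟨x', -, rfl⟩ := List.mem_map.1
        (Eq.mp (congrArg (x ∈ ·) (Walk.support_map (Embedding.induce _).toHom p)) hx)
      exact (key v hv _).2 x'.2)
    hcard Y hYX
  refine ⟨X ∪ M, subset_union_left, hYM.trans subset_union_right,
    (ncard_union_le _ _).trans (by gcongr), fun C hC hCM => ?_⟩
  obtain ⟨i, j, hij⟩ := hM C hC hCM
  refine (ncard_le_ncard (t := (↑) '' bag i ∪ (↑) '' bag j) ?_).trans
    ((ncard_union_le _ _).trans (by have := hcard i; have := hcard j; lia))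
  rintro w ⟨hw, c, hc, hcw⟩
  rcases hw with hw | hw
  · have := hXY w hw c hcw.symm
    refine absurd ?_ (Set.disjoint_left.1 hCM hc)
    exact this.imp id fun h => hYM h
  · exact hij c hc w hw hcw

end SimpleGraph

namespace SimpleGraph

variable {V : Type}

/-- `H` has no five pairwise disjoint, pairwise touching connected sets, i.e. no `K₅` minor. -/
def NoFiveTouching (H : SimpleGraph V) : Prop :=
  ∀ T : Fin 5 → Set V, (∀ i, H.ConnOn (T i)) → (∀ i j, i ≠ j → Disjoint (T i) (T j)) →
    ¬ ∀ i j, i ≠ j → ∃ a ∈ T i, ∃ b ∈ T j, H.Adj a b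

/-- `LayerReach H M B A n v`: there is a walk inside `B` from `A` to `v` that meets `M` at most
`n` times. -/
inductive LayerReach (H : SimpleGraph V) (M B A : Set V) : ℕ → V → Prop
  | start_free {n v} : v ∈ A → v ∉ M → LayerReach H M B A n v
  | start_mark {n v} : v ∈ A → v ∈ M → LayerReach H M B A (n + 1) v
  | step_free {n u v} : LayerReach H M B A n u → H.Adj u v → v ∈ B → v ∉ M →
      LayerReach H M B A n v
  | step_mark {n u v} : LayerReach H M B A n u → H.Adj u v → v ∈ B → v ∈ M →
      LayerReach H M B A (n + 1) v

namespace LayerReach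

variable {H : SimpleGraph V} {M B A : Set V} {n : ℕ} {u v : V}

theorem succ (h : LayerReach H M B A n v) : LayerReach H M B A (n + 1) v := by
  induction h with
  | start_free h1 h2 => exact start_free h1 h2
  | start_mark h1 h2 => exact start_mark h1 h2
  | step_free _ h1 h2 h3 ih => exact ih.step_free h1 h2 h3
  | step_mark _ h1 h2 h3 ih => exact ih.step_mark h1 h2 h3

theorem mono {m : ℕ} (hnm : n ≤ m) (h : LayerReach H M B A n v) : LayerReach H M B A m v := by
  induction hnm with
  | refl => exact h
  | step _ ih => exact ih.succ

theorem mem (hA : A ⊆ B) (h : LayerReach H M B A n v) : v ∈ B := by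
  cases h with
  | start_free h1 h2 => exact hA h1
  | start_mark h1 h2 => exact hA h1
  | step_free _ _ h _ => exact h
  | step_mark _ _ h _ => exact h

theorem pred_of_mem (hv : v ∈ M) (h : LayerReach H M B A (n + 1) v) :
    v ∈ A ∨ ∃ u, LayerReach H M B A n u ∧ H.Adj u v := by
  cases h with
  | start_free h1 h2 => exact absurd hv h2
  | start_mark h1 h2 => exact Or.inl h1
  | step_free _ _ _ h => exact absurd hv h
  | step_mark h1 h2 _ _ => exact Or.inr ⟨_, h1, h2⟩

end LayerReach

/-- The marked vertices at distance exactly `n + 1`. -/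
def layer (H : SimpleGraph V) (M B A : Set V) (n : ℕ) : Set V :=
  {v | v ∈ M ∧ LayerReach H M B A (n + 1) v ∧ ¬ LayerReach H M B A n v}

section Layer

variable {H : SimpleGraph V} {M B A : Set V} {n : ℕ} {u v : V}

theorem LayerReach.mem_layer (h : LayerReach H M B A n u) (huv : H.Adj u v) (hv : v ∈ B)
    (hn : ¬ LayerReach H M B A n v) : v ∈ layer H M B A n := by
  have hvM : v ∈ M := by
    by_contra hvM
    exact hn (h.step_free huv hv hvM)
  exact ⟨hvM, h.step_mark huv hv hvM, hn⟩

theorem mem_layer_of_mem (hv : v ∈ A) (hn : ¬ LayerReach H M B A n v) :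
    v ∈ layer H M B A n := by
  have hvM : v ∈ M := by
    by_contra hvM
    exact hn (.start_free hv hvM)
  exact ⟨hvM, .start_mark hv hvM, hn⟩

theorem exists_layer_ncard_le [Finite V] (H : SimpleGraph V) (M B A : Set V) {N z : ℕ}
    (hN : 0 < N) (hM : M.ncard ≤ N * z) : ∃ n < N, (layer H M B A n).ncard ≤ z := by
  by_contra! h
  have key : ∀ k ≤ N, k * (z + 1) ≤ {v | v ∈ M ∧ LayerReach H M B A k v}.ncard := by
    intro k hk
    induction k with
    | zero => simp
    | succ k ih =>
      have h1 := ih (by lia)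
      have h2 := h k (by lia)
      have h3 : Disjoint {v | v ∈ M ∧ LayerReach H M B A k v} (layer H M B A k) :=
        Set.disjoint_left.2 fun x hx hx' => hx'.2.2 hx.2
      have h4 : {v | v ∈ M ∧ LayerReach H M B A k v} ∪ layer H M B A k ⊆
          {v | v ∈ M ∧ LayerReach H M B A (k + 1) v} := by
        rintro x (hx | hx)
        exacts [⟨hx.1, hx.2.succ⟩, ⟨hx.1, hx.2.1⟩]
      have h5 := ncard_le_ncard h4
      rw [ncard_union_eq h3] at h5
      rw [add_mul]
      lia
  have h1 := key N le_rfl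
  have h2 : {v | v ∈ M ∧ LayerReach H M B A N v}.ncard ≤ M.ncard :=
    ncard_le_ncard fun x hx => hx.1
  rw [mul_add] at h1
  lia

theorem connOn_union_layer {T Z : Set V} (hT : H.ConnOn T) (hZT : Z ⊆ T)
    (hA : ∀ a ∈ A, ∃ y ∈ Z, H.Adj y a) :
    H.ConnOn (T ∪ ({v | LayerReach H M B A n v} ∪ layer H M B A n)) := by
  obtain ⟨t, ht⟩ := hT.1
  refine ConnOn.of_base (t := t) (Or.inl ht) fun D htD hD => ?_
  have hTD : T ⊆ D :=
    hT.2 D ⟨t, htD, ht⟩ fun a ha b hb hab => hD a ⟨ha.1, Or.inl ha.2⟩ b (Or.inl hb) hab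
  have hAD : ∀ a ∈ A, a ∈ T ∪ ({v | LayerReach H M B A n v} ∪ layer H M B A n) → a ∈ D := by
    intro a ha haE
    obtain ⟨y, hy, hya⟩ := hA a ha
    exact hD y ⟨hTD (hZT hy), Or.inl (hZT hy)⟩ a haE hya
  have hI : ∀ m v, LayerReach H M B A m v → m ≤ n → v ∈ D := by
    intro m v h
    induction h with
    | start_free h1 h2 => exact fun hm => hAD _ h1 (Or.inr (Or.inl (.start_free h1 h2)))
    | start_mark h1 h2 =>
      exact fun hm => hAD _ h1 (Or.inr (Or.inl ((LayerReach.start_mark h1 h2).mono hm)))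
    | step_free h0 h1 h2 h3 ih =>
      exact fun hm => hD _ ⟨ih hm, Or.inr (Or.inl (h0.mono hm))⟩ _
        (Or.inr (Or.inl ((h0.step_free h1 h2 h3).mono hm))) h1
    | step_mark h0 h1 h2 h3 ih =>
      exact fun hm => hD _ ⟨ih (by lia), Or.inr (Or.inl (h0.mono (by lia)))⟩ _
        (Or.inr (Or.inl ((h0.step_mark h1 h2 h3).mono hm))) h1
  refine union_subset hTD (union_subset (fun v hv => hI n v hv le_rfl) fun v hv => ?_)
  rcases hv.2.1.pred_of_mem hv.1 with h | ⟨u, hu, huv⟩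
  · exact hAD v h (Or.inr (Or.inr hv))
  · exact hD u ⟨hI n u hu le_rfl, Or.inr (Or.inl hu)⟩ v (Or.inr (Or.inr hv)) huv

theorem exists_closed_component [Finite V] {q : ℕ}
    (hq : ∀ C, H.ConnOn C → Disjoint C M → {w | w ∈ M ∧ ∃ c ∈ C, H.Adj c w}.ncard ≤ q)
    (hv : v ∈ B) (hvM : v ∉ M) :
    ∃ Q, H.ConnOn Q ∧ v ∈ Q ∧ Q ⊆ B ∧ (∀ x ∈ Q, x ∉ M → ∀ w ∈ B, H.Adj x w → w ∈ Q) ∧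
      (Q ∩ M).ncard ≤ q := by
  obtain ⟨C, hvC, hC, hCS, hexit⟩ := (ConnOn.singleton H v).exists_maximal (S := M ∪ Bᶜ)
    (by simpa using ⟨hvM, hv⟩)
  rw [disjoint_union_right, disjoint_compl_right_iff_subset] at hCS
  obtain ⟨c₀, hc₀⟩ := hC.1
  refine ⟨C ∪ {w | w ∈ M ∩ B ∧ ∃ c ∈ C, H.Adj c w}, ?_, Or.inl (hvC rfl), ?_, ?_, ?_⟩
  · refine ConnOn.of_base (t := c₀) (Or.inl hc₀) fun D hD0 hD => ?_
    have hCD : C ⊆ D :=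
      hC.2 D ⟨c₀, hD0, hc₀⟩ fun a ha b hb hab => hD a ⟨ha.1, Or.inl ha.2⟩ b (Or.inl hb) hab
    refine union_subset hCD ?_
    rintro w ⟨hw, c, hc, hcw⟩
    exact hD c ⟨hCD hc, Or.inl hc⟩ w (Or.inr ⟨hw, c, hc, hcw⟩) hcw
  · exact union_subset hCS.2 fun w hw => hw.1.2
  · rintro x (hx | hx) hxM w hw hxw
    · by_cases hwC : w ∈ C
      · exact Or.inl hwC
      · rcases hexit x hx w hxw hwC with h | h
        · exact Or.inr ⟨⟨h, hw⟩, x, hx, hxw⟩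
        · exact absurd hw h
    · exact absurd hx.1.1 hxM
  · refine (ncard_le_ncard ?_).trans (hq C hC hCS.1)
    rintro w ⟨hw | hw, hwM⟩
    · exact absurd hwM (Set.disjoint_left.1 hCS.1 hw)
    · exact ⟨hwM, hw.2⟩

open Classical in
theorem LayerReach.exists_closed [Finite V] {q : ℕ}
    (hq : ∀ C, H.ConnOn C → Disjoint C M → {w | w ∈ M ∧ ∃ c ∈ C, H.Adj c w}.ncard ≤ q)
    (hAB : A ⊆ B) (h : LayerReach H M B A n v) :
    ∃ Q, H.ConnOn Q ∧ v ∈ Q ∧ Q ⊆ B ∧ (Q ∩ A).Nonempty ∧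
      (∀ x ∈ Q, x ∉ M → ∀ w ∈ B, H.Adj x w → w ∈ Q) ∧
      (Q ∩ M).ncard ≤ n * (q + 1) + if v ∈ M then 0 else q := by
  induction h with
  | @start_free n v h1 h2 =>
    obtain ⟨Q, hQ, hvQ, hQB, hcl, hc⟩ := exists_closed_component hq (hAB h1) h2
    exact ⟨Q, hQ, hvQ, hQB, ⟨v, hvQ, h1⟩, hcl, by simp only [h2, if_false]; lia⟩
  | @start_mark n v h1 h2 =>
    refine ⟨{v}, ConnOn.singleton H v, rfl, by simpa using hAB h1, ⟨v, rfl, h1⟩, ?_, ?_⟩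
    · rintro x rfl hx
      exact absurd h2 hx
    · refine (ncard_le_ncard inter_subset_left).trans ?_
      rw [ncard_singleton, add_mul]
      lia
  | @step_free n u v h0 h1 h2 h3 ih =>
    obtain ⟨Q, hQ, huQ, hQB, hQA, hcl, hc⟩ := ih
    by_cases hu : u ∈ M
    · obtain ⟨Q', hQ', hvQ', hQB', hcl', hc'⟩ := exists_closed_component hq h2 h3
      refine ⟨Q ∪ Q', hQ.union_of_adj hQ' huQ hvQ' h1, Or.inr hvQ', union_subset hQB hQB',
        hQA.mono (inter_subset_inter_left _ subset_union_left), ?_, ?_⟩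
      · rintro x (hx | hx) hxM w hw hxw
        exacts [Or.inl (hcl x hx hxM w hw hxw), Or.inr (hcl' x hx hxM w hw hxw)]
      · rw [union_inter_distrib_right]
        refine (ncard_union_le _ _).trans ?_
        simp only [hu, h3, if_true, if_false] at hc ⊢
        lia
    · refine ⟨Q, hQ, hcl u huQ hu v h2 h1, hQB, hQA, hcl, ?_⟩
      simpa only [hu, h3, if_false] using hc
  | @step_mark n u v h0 h1 h2 h3 ih =>
    obtain ⟨Q, hQ, huQ, hQB, hQA, hcl, hc⟩ := ih
    by_cases hu : u ∈ M
    · refine ⟨insert v Q, hQ.insert huQ h1, mem_insert _ _, insert_subset h2 hQB,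
        hQA.mono (inter_subset_inter_left _ (subset_insert _ _)), ?_, ?_⟩
      · rintro x (rfl | hx) hxM w hw hxw
        exacts [absurd h3 hxM, Or.inr (hcl x hx hxM w hw hxw)]
      · have h4 : insert v Q ∩ M ⊆ insert v (Q ∩ M) := by
          rintro x ⟨rfl | hx, hxM⟩
          exacts [mem_insert _ _, Or.inr ⟨hx, hxM⟩]
        refine (ncard_le_ncard h4).trans ((ncard_insert_le _ _).trans ?_)
        simp only [hu, if_true] at hc
        rw [add_mul]
        lia
    · refine ⟨Q, hQ, hcl u huQ hu v h2 h1, hQB, hQA, hcl, ?_⟩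
      simp only [hu, if_false] at hc
      rw [add_mul]
      lia

end Layer

/-- A partial clique-minor model `𝒞`, each branch set paired with its set of portals, together
with a big connected set `B` cut off by the portals. -/
structure PartialModel (H : SimpleGraph V) (Big : Set V → Prop) (z : ℕ)
    (𝒞 : Finset (Set V × Set V)) (B : Set V) : Prop where
  card_le : 𝒞.card ≤ 4
  connOn : ∀ p ∈ 𝒞, H.ConnOn p.1
  portal_subset : ∀ p ∈ 𝒞, p.2 ⊆ p.1
  portal_ncard : ∀ p ∈ 𝒞, p.2.ncard ≤ z
  disjoint_big : ∀ p ∈ 𝒞, Disjoint p.1 B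
  disjoint : ∀ p ∈ 𝒞, ∀ p' ∈ 𝒞, p ≠ p' → Disjoint p.1 p'.1
  touch : ∀ p ∈ 𝒞, ∀ p' ∈ 𝒞, p ≠ p' → ∃ a ∈ p.1, ∃ b ∈ p'.1, H.Adj a b
  big_connOn : H.ConnOn B
  big : Big B
  exits : ∀ b ∈ B, ∀ w, H.Adj b w → w ∉ B → ∃ p ∈ 𝒞, w ∈ p.2

theorem ncard_biUnion_le_mul {α : Type*} [Finite V] (s : Finset α) (f : α → Set V) {z : ℕ}
    (h : ∀ a ∈ s, (f a).ncard ≤ z) : (⋃ a ∈ s, f a).ncard ≤ s.card * z := by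
  classical
  induction s using Finset.induction_on with
  | empty => simp
  | insert a s ha ih =>
    rw [Finset.set_biUnion_insert, Finset.card_insert_of_notMem ha, add_mul, one_mul, add_comm]
    exact (ncard_union_le _ _).trans (Nat.add_le_add (h a (by simp))
      (ih fun b hb => h b (Finset.mem_insert_of_mem hb)))

theorem PartialModel.insert [DecidableEq (Set V × Set V)] {H : SimpleGraph V}
    {Big : Set V → Prop} {z : ℕ} {𝒞 : Finset (Set V × Set V)} {B B' T Z : Set V}
    (h1 : 𝒞.card ≤ 3) (h2 : ∀ p ∈ 𝒞, H.ConnOn p.1) (h3 : ∀ p ∈ 𝒞, p.2 ⊆ p.1)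
    (h4 : ∀ p ∈ 𝒞, p.2.ncard ≤ z) (h5 : ∀ p ∈ 𝒞, Disjoint p.1 B)
    (h6 : ∀ p ∈ 𝒞, ∀ p' ∈ 𝒞, p ≠ p' → Disjoint p.1 p'.1)
    (h7 : ∀ p ∈ 𝒞, ∀ p' ∈ 𝒞, p ≠ p' → ∃ a ∈ p.1, ∃ b ∈ p'.1, H.Adj a b)
    (hT : H.ConnOn T) (hZT : Z ⊆ T) (hZ : Z.ncard ≤ z)
    (hT𝒞 : ∀ p ∈ 𝒞, Disjoint p.1 T) (htouch : ∀ p ∈ 𝒞, ∃ a ∈ p.1, ∃ b ∈ T, H.Adj a b)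
    (hB'B : B' ⊆ B) (hTB' : Disjoint T B') (hB' : H.ConnOn B') (hbig : Big B')
    (hex : ∀ b ∈ B', ∀ w, H.Adj b w → w ∉ B' → w ∈ ⋃ p ∈ insert (T, Z) 𝒞, p.2) :
    H.PartialModel Big z (insert (T, Z) 𝒞) B' where
  card_le := (Finset.card_insert_le _ _).trans (by lia)
  connOn := by simpa [hT] using fun a b => h2 (a, b)
  portal_subset := by simpa [hZT] using fun a b => h3 (a, b)
  portal_ncard := by simpa [hZ] using fun a b => h4 (a, b)
  disjoint_big := by
    simpa [hTB'] using fun a b hab => (h5 (a, b) hab).mono_right hB'B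
  disjoint := by
    intro p hp p' hp' hne
    rcases Finset.mem_insert.1 hp with rfl | hp
    · rcases Finset.mem_insert.1 hp' with rfl | hp'
      · exact absurd rfl hne
      · exact (hT𝒞 _ hp').symm
    · rcases Finset.mem_insert.1 hp' with rfl | hp'
      · exact hT𝒞 _ hp
      · exact h6 _ hp _ hp' hne
  touch := by
    intro p hp p' hp' hne
    rcases Finset.mem_insert.1 hp with rfl | hp
    · rcases Finset.mem_insert.1 hp' with rfl | hp'
      · exact absurd rfl hne
      · obtain ⟨a, ha, b, hb, hab⟩ := htouch _ hp'
        exact ⟨b, hb, a, ha, hab.symm⟩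
    · rcases Finset.mem_insert.1 hp' with rfl | hp'
      · exact htouch _ hp
      · exact h7 _ hp _ hp' hne
  big_connOn := hB'
  big := hbig
  exits := by simpa only [mem_iUnion, exists_prop] using hex

/-- A balanced separator theorem for graphs without a `K₅` minor, in terms of a set `M` of marked
vertices such that every connected set avoiding `M` has few neighbours in `M`. -/
theorem NoFiveTouching.exists_separator [Finite V] {H : SimpleGraph V} (hH : H.NoFiveTouching)
    {M : Set V} {Big : Set V → Prop} {q N z : ℕ}
    (hmono : ∀ A B, A ⊆ B → Big A → Big B)
    (hinter : ∀ A B, Big A → Big B → (A ∩ B).Nonempty)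
    (hmeet : ∀ A, Big A → (A ∩ M).Nonempty)
    (hq : ∀ C, H.ConnOn C → Disjoint C M → {w | w ∈ M ∧ ∃ c ∈ C, H.Adj c w}.ncard ≤ q)
    (hN : 0 < N) (hMN : M.ncard ≤ N * z) (hz : 4 * N * (q + 1) ≤ z) :
    ∃ S : Set V, S.ncard ≤ 8 * z ∧ ∀ W, H.ConnOn W → Disjoint W S → ¬ Big W := by
  classical
  by_contra! hcon
  have hex : ∀ S : Set V, S.ncard ≤ 8 * z → ∃ B, H.ConnOn B ∧ Disjoint B S ∧ Big B ∧
      ∀ b ∈ B, ∀ w, H.Adj b w → w ∉ B → w ∈ S := by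
    intro S hS
    obtain ⟨W, hW, hWS, hWb⟩ := hcon S hS
    obtain ⟨B, hWB, hB, hBS, hexit⟩ := hW.exists_maximal hWS
    exact ⟨B, hB, hBS, hmono _ _ hWB hWb, hexit⟩
  suffices ∀ (n : ℕ) (𝒞 : Finset (Set V × Set V)) (B : Set V),
      5 * B.ncard + 𝒞.card = n → ¬ H.PartialModel Big z 𝒞 B by
    obtain ⟨B, hB, -, hBb, hexit⟩ := hex ∅ (by simp)
    refine this _ ∅ B rfl ⟨by simp, by simp, by simp, by simp, by simp, by simp, by simp,
      hB, hBb, fun b hb w hbw hw => ?_⟩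
    exact absurd (hexit b hb w hbw hw) (notMem_empty _)
  intro n
  induction n using Nat.strong_induction_on with
  | _ n ih =>
  intro 𝒞 B hn h𝒞
  let A : Set V × Set V → Set V := fun p => {b | b ∈ B ∧ ∃ y ∈ p.2, H.Adj y b}
  have hAB : ∀ p, A p ⊆ B := fun p b hb => hb.1
  have hAne : ∀ p ∈ 𝒞, (A p).Nonempty := by
    intro p hp
    by_contra hne
    rw [not_nonempty_iff_eq_empty] at hne
    have hcard := Finset.card_erase_lt_of_mem hp
    refine ih _ (by lia) (𝒞.erase p) B rfl ?_
    have hsub := Finset.erase_subset p 𝒞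
    refine ⟨by have := h𝒞.card_le; lia, fun p hp => h𝒞.connOn p (hsub hp),
      fun p hp => h𝒞.portal_subset p (hsub hp), fun p hp => h𝒞.portal_ncard p (hsub hp),
      fun p hp => h𝒞.disjoint_big p (hsub hp),
      fun p hp p' hp' => h𝒞.disjoint p (hsub hp) p' (hsub hp'),
      fun p hp p' hp' => h𝒞.touch p (hsub hp) p' (hsub hp'), h𝒞.big_connOn, h𝒞.big, ?_⟩
    intro b hb w hbw hw
    obtain ⟨p', hp', hwp'⟩ := h𝒞.exits b hb w hbw hw
    refine ⟨p', Finset.mem_erase.2 ⟨?_, hp'⟩, hwp'⟩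
    rintro rfl
    have : b ∈ A p' := ⟨hb, w, hwp', hbw.symm⟩
    rw [hne] at this
    exact this
  choose m hmN hmz using fun p => exists_layer_ncard_le H M B (A p) hN hMN
  let I : Set V × Set V → Set V := fun p => {v | LayerReach H M B (A p) (m p) v}
  let L : Set V × Set V → Set V := fun p => layer H M B (A p) (m p)
  have hIB : ∀ p, I p ⊆ B := fun p v hv => LayerReach.mem (hAB p) hv
  have hLB : ∀ p, L p ⊆ B := fun p v hv => LayerReach.mem (hAB p) hv.2.1
  obtain ⟨K, hK, hKS, hKb, -⟩ := hex (⋃ p ∈ 𝒞, (p.2 ∪ L p)) <| by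
    refine (ncard_biUnion_le_mul (z := 2 * z) _ _ fun p hp => ?_).trans ?_
    · have h1 := h𝒞.portal_ncard p hp
      have h2 : (L p).ncard ≤ z := hmz p
      have h3 := ncard_union_le p.2 (L p)
      lia
    · have := Nat.mul_le_mul_right (2 * z) h𝒞.card_le
      lia
  have hKZ : ∀ p ∈ 𝒞, ∀ x ∈ K, x ∉ p.2 := fun p hp x hx hxp =>
    Set.disjoint_left.1 hKS hx (mem_iUnion₂.2 ⟨p, hp, Or.inl hxp⟩)
  have hKL : ∀ p ∈ 𝒞, ∀ x ∈ K, x ∉ L p := fun p hp x hx hxp =>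
    Set.disjoint_left.1 hKS hx (mem_iUnion₂.2 ⟨p, hp, Or.inr hxp⟩)
  have hsubB : ∀ K, H.ConnOn K → Big K → (∀ p ∈ 𝒞, ∀ x ∈ K, x ∉ p.2) → K ⊆ B := by
    intro K hK hKb hKZ
    refine hK.subset_of_exits (S := ⋃ p ∈ 𝒞, p.2) (hinter _ _ hKb h𝒞.big) ?_ ?_
    · simpa only [mem_iUnion, exists_prop] using h𝒞.exits
    · rw [Set.disjoint_left]
      intro x hx hx'
      obtain ⟨p, hp, hxp⟩ := mem_iUnion₂.1 hx'
      exact hKZ p hp x hx hxp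
  have hKB := hsubB K hK hKb hKZ
  by_cases hin : ∀ p ∈ 𝒞, K ⊆ I p
  · obtain ⟨v, hvK, hvM⟩ := hmeet K hKb
    have hQ : ∀ p ∈ 𝒞, ∃ Q, H.ConnOn Q ∧ v ∈ Q ∧ Q ⊆ B ∧ (Q ∩ A p).Nonempty ∧
      (∀ x ∈ Q, x ∉ M → ∀ w ∈ B, H.Adj x w → w ∈ Q) ∧
      (Q ∩ M).ncard ≤ (N - 1) * (q + 1) := by
      intro p hp
      obtain ⟨Q, h1, h2, h3, h4, h5, h6⟩ := LayerReach.exists_closed hq (hAB p) (hin p hp hvK)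
      refine ⟨Q, h1, h2, h3, h4, h5, h6.trans ?_⟩
      simp only [hvM, if_true, add_zero]
      have := hmN p
      gcongr
      lia
    choose! Q hQ hvQ hQB hQA hQcl hQM using hQ
    let T : Set V := {v} ∪ ⋃ p ∈ 𝒞, Q p
    have hT : H.ConnOn T := by
      refine ConnOn.of_base (t := v) (Or.inl rfl) fun D hvD hD => ?_
      refine union_subset (by simpa) (iUnion₂_subset fun p hp => ?_)
      have hQT : Q p ⊆ T := (subset_biUnion_of_mem (u := Q) hp).trans subset_union_right
      exact (hQ p hp).2 D ⟨v, hvD, hvQ p hp⟩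
        fun a ha b hb hab => hD a ⟨ha.1, hQT ha.2⟩ b (hQT hb) hab
    have hTB : T ⊆ B := union_subset (by simpa using hKB hvK) (iUnion₂_subset hQB)
    have hTcl : ∀ x ∈ T, x ∉ M → ∀ w ∈ B, H.Adj x w → w ∈ T := by
      rintro x (rfl | hx) hxM w hw hxw
      · exact absurd hvM hxM
      · obtain ⟨p, hp, hxp⟩ := mem_iUnion₂.1 hx
        exact Or.inr (mem_iUnion₂.2 ⟨p, hp, hQcl p hp x hxp hxM w hw hxw⟩)
    have hTM : (T ∩ M).ncard ≤ z := by
      have h1 : T ∩ M ⊆ {v} ∪ ⋃ p ∈ 𝒞, Q p ∩ M := by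
        rintro x ⟨hx | hx, hxM⟩
        · exact Or.inl hx
        · obtain ⟨p, hp, hxp⟩ := mem_iUnion₂.1 hx
          exact Or.inr (mem_iUnion₂.2 ⟨p, hp, hxp, hxM⟩)
      have h2 := ncard_biUnion_le_mul 𝒞 (fun p => Q p ∩ M) hQM
      have h3 := Nat.mul_le_mul_right ((N - 1) * (q + 1)) h𝒞.card_le
      have h4 := (ncard_le_ncard h1).trans (ncard_union_le _ _)
      rw [ncard_singleton] at h4
      obtain ⟨N, rfl⟩ : ∃ N', N = N' + 1 := ⟨N - 1, by lia⟩
      simp only [Nat.add_sub_cancel] at h2 h3 h4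
      have h5 : 4 * (N + 1) * (q + 1) = 4 * (N * (q + 1)) + 4 * (q + 1) := by ring
      lia
    have htouch : ∀ p ∈ 𝒞, ∃ a ∈ p.1, ∃ b ∈ T, H.Adj a b := by
      intro p hp
      obtain ⟨b, hbQ, -, y, hy, hyb⟩ := hQA p hp
      exact ⟨y, h𝒞.portal_subset p hp hy, b, Or.inr (mem_iUnion₂.2 ⟨p, hp, hbQ⟩), hyb⟩
    have hdisj : ∀ p ∈ 𝒞, Disjoint p.1 T := fun p hp => (h𝒞.disjoint_big p hp).mono_right hTB
    rcases Nat.lt_or_ge 𝒞.card 4 with hlt | hge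
    · obtain ⟨B', hB', hB'S, hB'b, hexit⟩ := hex (⋃ p ∈ insert (T, T ∩ M) 𝒞, p.2) <| by
        refine (ncard_biUnion_le_mul (z := z) _ _ fun p hp => ?_).trans ?_
        · rcases Finset.mem_insert.1 hp with rfl | hp
          exacts [hTM, h𝒞.portal_ncard p hp]
        · have := Nat.mul_le_mul_right z ((Finset.card_insert_le (T, T ∩ M) 𝒞).trans hlt)
          lia
      have hB'B : B' ⊆ B := hsubB B' hB' hB'b fun p hp x hx hxp =>
        Set.disjoint_left.1 hB'S hx (mem_iUnion₂.2 ⟨p, Finset.mem_insert_of_mem hp, hxp⟩)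
      have hB'TM : ∀ x ∈ B', x ∈ T → x ∉ M := fun x hx hxT hxM =>
        Set.disjoint_left.1 hB'S hx
          (mem_iUnion₂.2 ⟨_, Finset.mem_insert_self _ _, hxT, hxM⟩)
      have hTB' : Disjoint T B' := by
        rw [Set.disjoint_left]
        intro x hxT hx
        have : B' ⊆ T \ M := hB'.2 _ ⟨x, ⟨hxT, hB'TM x hx hxT⟩, hx⟩ fun a ha b hb hab => by
          have hbT := hTcl a ha.1.1 ha.1.2 b (hB'B hb) hab
          exact ⟨hbT, hB'TM b hb hbT⟩
        obtain ⟨y, hy, hyM⟩ := hmeet B' hB'b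
        exact (this hy).2 hyM
      refine ih _ ?_ (insert (T, T ∩ M) 𝒞) B' rfl (PartialModel.insert (by lia)
        h𝒞.connOn h𝒞.portal_subset h𝒞.portal_ncard h𝒞.disjoint_big h𝒞.disjoint h𝒞.touch hT
        inter_subset_left hTM hdisj htouch hB'B hTB' hB' hB'b hexit)
      have h1 : B'.ncard < B.ncard := ncard_lt_ncard
        ⟨hB'B, fun h => Set.disjoint_left.1 hTB' (Or.inl rfl) (h (hKB hvK))⟩
      have h2 := Finset.card_insert_le (T, T ∩ M) 𝒞
      lia
    · have hcard : 𝒞.card = 4 := le_antisymm h𝒞.card_le hge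
      let e := (Finset.equivFinOfCardEq hcard).symm
      have hne : ∀ i j, i ≠ j → (e i : Set V × Set V) ≠ e j := fun i j hij h =>
        hij (e.injective (Subtype.ext h))
      refine hH (Fin.cons T fun i => (e i : Set V × Set V).1) ?_ ?_ ?_
      · refine Fin.cases hT fun i => ?_
        simpa using h𝒞.connOn _ (e i).2
      · refine Fin.cases (Fin.cases (by simp) fun j _ => ?_) fun i => Fin.cases (fun _ => ?_)
          fun j hij => ?_
        · simpa using (hdisj _ (e j).2).symm
        · simpa using hdisj _ (e i).2
        · simpa using h𝒞.disjoint _ (e i).2 _ (e j).2 (hne i j (by simpa using hij))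
      · refine Fin.cases (Fin.cases (by simp) fun j _ => ?_) fun i => Fin.cases (fun _ => ?_)
          fun j hij => ?_
        · obtain ⟨a, ha, b, hb, hab⟩ := htouch _ (e j).2
          exact ⟨b, by simpa using hb, a, by simpa using ha, hab.symm⟩
        · simpa using htouch _ (e i).2
        · simpa using h𝒞.touch _ (e i).2 _ (e j).2 (hne i j (by simpa using hij))
  · push Not at hin
    obtain ⟨p, hp, hKI⟩ := hin
    have hKdisj : ∀ x ∈ K, x ∉ I p := by
      intro x hx hxI
      refine hKI (hK.2 (I p) ⟨x, hxI, hx⟩ fun a ha b hb hab => ?_)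
      by_contra hbI
      exact hKL p hp b hb (LayerReach.mem_layer ha.1 hab (hKB hb) hbI)
    let T : Set V := p.1 ∪ (I p ∪ L p)
    have hT : H.ConnOn T :=
      connOn_union_layer (h𝒞.connOn p hp) (h𝒞.portal_subset p hp) fun a ha => ha.2
    have hsub := Finset.erase_subset p 𝒞
    obtain ⟨B', hKB', hB', hB'S, hexit⟩ := hK.exists_maximal
      (S := ⋃ p' ∈ insert (T, L p) (𝒞.erase p), p'.2) <| by
      rw [Set.disjoint_left]
      intro x hx hx'
      obtain ⟨p', hp', hxp'⟩ := mem_iUnion₂.1 hx'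
      rcases Finset.mem_insert.1 hp' with rfl | hp'
      · exact hKL p hp x hx hxp'
      · exact hKZ p' (hsub hp') x hx hxp'
    have hB'L : ∀ x ∈ B', x ∉ L p := fun x hx hxL =>
      Set.disjoint_left.1 hB'S hx (mem_iUnion₂.2 ⟨_, Finset.mem_insert_self _ _, hxL⟩)
    have hB'Z : ∀ x ∈ B', ∀ p' ∈ 𝒞, p' ≠ p → x ∉ p'.2 := fun x hx p' hp' hne hxp' =>
      Set.disjoint_left.1 hB'S hx (mem_iUnion₂.2 ⟨_, Finset.mem_insert_of_mem
        (Finset.mem_erase.2 ⟨hne, hp'⟩), hxp'⟩)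
    have hB'B : B' ⊆ B \ (I p ∪ L p) := by
      obtain ⟨x, hx⟩ := hK.1
      refine hB'.2 _ ⟨x, ⟨hKB hx, ?_⟩, hKB' hx⟩ ?_
      · rintro (h | h)
        exacts [hKdisj x hx h, hKL p hp x hx h]
      · rintro a ⟨⟨haB, haE⟩, haB'⟩ b hb hab
        have hbB : b ∈ B := by
          by_contra hbB
          obtain ⟨p', hp', hbp'⟩ := h𝒞.exits a haB b hab hbB
          by_cases hpp : p' = p
          · subst hpp
            refine haE (or_iff_not_imp_left.2 fun haI => ?_)
            exact mem_layer_of_mem ⟨haB, b, hbp', hab.symm⟩ haI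
          · exact hB'Z b hb p' hp' hpp hbp'
        refine ⟨hbB, ?_⟩
        rintro (h | h)
        · exact haE (or_iff_not_imp_left.2 fun haI => LayerReach.mem_layer h hab.symm haB haI)
        · exact hB'L b hb h
    have hTB' : Disjoint T B' := by
      rw [Set.disjoint_left]
      rintro x (hx | hx) hxB'
      · exact Set.disjoint_left.1 (h𝒞.disjoint_big p hp) hx (hB'B hxB').1
      · exact (hB'B hxB').2 hx
    have hne : ∀ p' ∈ 𝒞.erase p, p' ≠ p := fun p' hp' => (Finset.mem_erase.1 hp').1
    have hcard := Finset.card_erase_lt_of_mem hp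
    have hcard4 := h𝒞.card_le
    refine ih _ ?_ (insert (T, L p) (𝒞.erase p)) B' rfl (PartialModel.insert (B := B) (by lia)
      (fun p hp => h𝒞.connOn p (hsub hp))
      (fun p hp => h𝒞.portal_subset p (hsub hp)) (fun p hp => h𝒞.portal_ncard p (hsub hp))
      (fun p hp => h𝒞.disjoint_big p (hsub hp))
      (fun p hp p' hp' => h𝒞.disjoint p (hsub hp) p' (hsub hp'))
      (fun p hp p' hp' => h𝒞.touch p (hsub hp) p' (hsub hp')) hT
      (subset_union_right.trans subset_union_right) (hmz p) ?_ ?_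
      (hB'B.trans sdiff_subset) hTB' hB' (hmono _ _ hKB' hKb) hexit)
    · obtain ⟨a, ha⟩ := hAne p hp
      have haE : a ∈ I p ∪ L p := or_iff_not_imp_left.2 fun haI => mem_layer_of_mem ha haI
      have h1 : B'.ncard < B.ncard := ncard_lt_ncard
        ⟨hB'B.trans sdiff_subset, fun h => (hB'B (h ha.1)).2 haE⟩
      have h2 := Finset.card_insert_le (T, L p) (𝒞.erase p)
      lia
    · intro p' hp'
      refine disjoint_union_right.2 ⟨h𝒞.disjoint p' (hsub hp') p hp (hne p' hp'), ?_⟩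
      exact (h𝒞.disjoint_big p' (hsub hp')).mono_right (union_subset (hIB p) (hLB p))
    · intro p' hp'
      obtain ⟨a, ha, b, hb, hab⟩ := h𝒞.touch p' (hsub hp') p hp (hne p' hp')
      exact ⟨a, ha, b, Or.inl hb, hab⟩

end SimpleGraph

section Parity

variable {E : Type*} [AddCommGroup E] [Module ℝ E]

theorem two_zmod (a : ZMod 2) : a + a = 0 := CharTwo.add_self_eq_zero a

/-- Two polygonal curves parametrized by height whose horizontal order is reversed meet. -/
theorem exists_mem_segment_inter {X Y : E →ₗ[ℝ] ℝ} (hXY : ∀ p q, X p = X q → Y p = Y q → p = q)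
    {a b c d P₁ P₂ Q₁ Q₂ : E} (hP₁ : P₁ ∈ segment ℝ a b) (hP₂ : P₂ ∈ segment ℝ a b)
    (hQ₁ : Q₁ ∈ segment ℝ c d) (hQ₂ : Q₂ ∈ segment ℝ c d) (hY₁ : Y P₁ = Y Q₁)
    (hY₂ : Y P₂ = Y Q₂) (h₁ : X Q₁ ≤ X P₁) (h₂ : X P₂ ≤ X Q₂) :
    ¬ Disjoint (segment ℝ a b) (segment ℝ c d) := by
  intro hdis
  obtain ⟨s, t, hs, ht, hst, h⟩ : ∃ s t : ℝ, 0 ≤ s ∧ 0 ≤ t ∧ s + t = 1 ∧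
      s * (X P₁ - X Q₁) = t * (X Q₂ - X P₂) := by
    rcases eq_or_lt_of_le (add_nonneg (sub_nonneg.2 h₁) (sub_nonneg.2 h₂)) with h | h
    · exact ⟨1, 0, zero_le_one, le_rfl, by simp, by linarith⟩
    · refine ⟨(X Q₂ - X P₂) / (X P₁ - X Q₁ + (X Q₂ - X P₂)),
        (X P₁ - X Q₁) / (X P₁ - X Q₁ + (X Q₂ - X P₂)), div_nonneg (by linarith) h.le,
        div_nonneg (by linarith) h.le, ?_, by ring⟩
      rw [← add_div, add_comm, div_self h.ne']
  have hP := convex_segment a b hP₁ hP₂ hs ht hst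
  have hQ := convex_segment c d hQ₁ hQ₂ hs ht hst
  have : s • P₁ + t • P₂ = s • Q₁ + t • Q₂ := by
    refine hXY _ _ ?_ ?_
    · simp only [map_add, map_smul, smul_eq_mul]
      linarith
    · simp only [map_add, map_smul, smul_eq_mul, hY₁, hY₂]
  rw [this] at hP
  exact Set.disjoint_left.1 hdis hP hQ

theorem exists_mem_segment_height (Y : E →ₗ[ℝ] ℝ) {a b : E} {h : ℝ} (h₁ : Y a ≤ h)
    (h₂ : h ≤ Y b) : ∃ P ∈ segment ℝ a b, Y P = h := by
  have : h ∈ Y '' segment ℝ a b := by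
    have himg := image_segment ℝ Y.toAffineMap a b
    simp only [LinearMap.coe_toAffineMap] at himg
    rw [himg, segment_eq_uIcc]
    exact mem_uIcc_of_le h₁ h₂
  exact this

theorem height_mem_of_mem_segment (Y : E →ₗ[ℝ] ℝ) {a b P : E} (hP : P ∈ segment ℝ a b) :
    Y P ∈ uIcc (Y a) (Y b) := by
  have himg := image_segment ℝ Y.toAffineMap a b
  simp only [LinearMap.coe_toAffineMap] at himg
  rw [← segment_eq_uIcc, ← himg]
  exact mem_image_of_mem _ hP

open Classical in
/-- Parity of the number of crossings of the horizontal ray from `c` with the segment `ab`. -/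
noncomputable def rayCross (X Y : E →ₗ[ℝ] ℝ) (a b c : E) : ZMod 2 :=
  if ∃ P ∈ segment ℝ a b, Y P = Y c ∧ X c < X P then 1 else 0

open Classical in
/-- Indicator of `c` lying below `a`. -/
noncomputable def below (Y : E →ₗ[ℝ] ℝ) (c a : E) : ZMod 2 := if Y c < Y a then 1 else 0

variable {X Y : E →ₗ[ℝ] ℝ} {a b c d : E}

theorem rayCross_comm : rayCross X Y a b c = rayCross X Y b a c := by
  rw [rayCross, rayCross, segment_symm ℝ a b]

theorem rayCross_eq_zero (h : Y c ∉ uIcc (Y a) (Y b)) : rayCross X Y a b c = 0 := by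
  refine if_neg ?_
  rintro ⟨P, hP, hPc, -⟩
  exact h (hPc ▸ height_mem_of_mem_segment Y hP)

theorem below_add_below (h : Y a ≠ Y b) : below Y a b + below Y b a = 1 := by
  rcases lt_or_gt_of_ne h with h | h <;> simp [below, h, h.le]

theorem rayCross_identity_of_lt (hXY : ∀ p q, X p = X q → Y p = Y q → p = q)
    (hdis : Disjoint (segment ℝ a b) (segment ℝ c d)) (hbc : Y b ≠ Y c) (hbd : Y b ≠ Y d)
    (hab : Y a ≤ Y b) (hcd : Y c ≤ Y d) (hac : Y a < Y c) :
    rayCross X Y a b c + rayCross X Y a b d + rayCross X Y c d a + rayCross X Y c d b =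
      below Y c a + below Y d a + below Y c b + below Y d b := by
  have h1 : rayCross X Y c d a = 0 := rayCross_eq_zero (by
    rw [uIcc_of_le hcd, mem_Icc]; intro h; linarith [h.1])
  have h2 : below Y c a = 0 := if_neg (not_lt.2 hac.le)
  have h3 : below Y d a = 0 := if_neg (not_lt.2 (hac.le.trans hcd))
  have hc := left_mem_segment ℝ c d
  have hd := right_mem_segment ℝ c d
  have hb := right_mem_segment ℝ a b
  rcases lt_or_gt_of_ne hbc with hbc | hbc
  · have h4 : rayCross X Y c d b = 0 := rayCross_eq_zero (by
      rw [uIcc_of_le hcd, mem_Icc]; intro h; linarith [h.1])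
    have h5 : rayCross X Y a b c = 0 := rayCross_eq_zero (by
      rw [uIcc_of_le hab, mem_Icc]; intro h; linarith [h.2])
    have h6 : rayCross X Y a b d = 0 := rayCross_eq_zero (by
      rw [uIcc_of_le hab, mem_Icc]; intro h; linarith [h.2])
    have h7 : below Y c b = 0 := if_neg (not_lt.2 hbc.le)
    have h8 : below Y d b = 0 := if_neg (not_lt.2 (hbc.le.trans hcd))
    rw [h1, h2, h3, h4, h5, h6, h7, h8]
  have h4 : below Y c b = 1 := if_pos hbc
  obtain ⟨P₁, hP₁, hP₁c⟩ := exists_mem_segment_height Y hac.le hbc.le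
  rcases lt_or_gt_of_ne hbd with hbd | hbd
  · have h5 : rayCross X Y a b d = 0 := rayCross_eq_zero (by
      rw [uIcc_of_le hab, mem_Icc]; intro h; linarith [h.2])
    have h6 : below Y d b = 0 := if_neg (not_lt.2 hbd.le)
    obtain ⟨Q₂, hQ₂, hQ₂b⟩ := exists_mem_segment_height Y hbc.le hbd.le
    have key : rayCross X Y a b c + rayCross X Y c d b = 1 := by
      by_cases hl : ∃ P ∈ segment ℝ a b, Y P = Y c ∧ X c < X P
      · by_cases hr : ∃ Q ∈ segment ℝ c d, Y Q = Y b ∧ X b < X Q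
        · obtain ⟨P, hP, hPc, hX⟩ := hl
          obtain ⟨Q, hQ, hQb, hX'⟩ := hr
          exact absurd hdis (exists_mem_segment_inter hXY hP hb hc hQ hPc hQb.symm hX.le hX'.le)
        · simp only [rayCross, if_pos hl, if_neg hr, add_zero]
      · by_cases hr : ∃ Q ∈ segment ℝ c d, Y Q = Y b ∧ X b < X Q
        · simp only [rayCross, if_neg hl, if_pos hr, zero_add]
        · push Not at hl hr
          exact absurd hdis.symm (exists_mem_segment_inter hXY hc hQ₂ hP₁ hb hP₁c.symm hQ₂b
            (hl P₁ hP₁ hP₁c) (hr Q₂ hQ₂ hQ₂b))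
    rw [h1, h2, h3, h4, h5, h6]
    simpa using key
  · have h5 : rayCross X Y c d b = 0 := rayCross_eq_zero (by
      rw [uIcc_of_le hcd, mem_Icc]; intro h; linarith [h.2])
    have h6 : below Y d b = 1 := if_pos hbd
    obtain ⟨P₂, hP₂, hP₂d⟩ := exists_mem_segment_height Y (hac.le.trans hcd) hbd.le
    have key : rayCross X Y a b c = rayCross X Y a b d := by
      by_cases hl : ∃ P ∈ segment ℝ a b, Y P = Y c ∧ X c < X P
      · by_cases hr : ∃ P ∈ segment ℝ a b, Y P = Y d ∧ X d < X P
        · simp only [rayCross, if_pos hl, if_pos hr]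
        · push Not at hr
          obtain ⟨P, hP, hPc, hX⟩ := hl
          exact absurd hdis (exists_mem_segment_inter hXY hP hP₂ hc hd hPc hP₂d hX.le
            (hr P₂ hP₂ hP₂d))
      · by_cases hr : ∃ P ∈ segment ℝ a b, Y P = Y d ∧ X d < X P
        · push Not at hl
          obtain ⟨P, hP, hPd, hX⟩ := hr
          exact absurd hdis (exists_mem_segment_inter hXY hP hP₁ hd hc hPd hP₁c hX.le
            (hl P₁ hP₁ hP₁c))
        · simp only [rayCross, if_neg hl, if_neg hr]
    rw [h1, h2, h3, h4, h5, h6, key, two_zmod]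
    decide

theorem rayCross_identity (hXY : ∀ p q, X p = X q → Y p = Y q → p = q)
    (hdis : Disjoint (segment ℝ a b) (segment ℝ c d)) (hac : Y a ≠ Y c) (had : Y a ≠ Y d)
    (hbc : Y b ≠ Y c) (hbd : Y b ≠ Y d) :
    rayCross X Y a b c + rayCross X Y a b d + rayCross X Y c d a + rayCross X Y c d b =
      below Y c a + below Y d a + below Y c b + below Y d b := by
  wlog hab : Y a ≤ Y b generalizing a b
  · have := this (by rwa [segment_symm]) hbc hbd hac had (le_of_not_ge hab)
    rw [rayCross_comm (a := a), rayCross_comm (a := a)]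
    linear_combination this
  wlog hcd : Y c ≤ Y d generalizing c d
  · have := this (by rwa [segment_symm ℝ d c]) had hac hbd hbc (le_of_not_ge hcd)
    rw [rayCross_comm (a := c), rayCross_comm (a := c)]
    linear_combination this
  rcases lt_or_gt_of_ne hac with h | h
  · exact rayCross_identity_of_lt hXY hdis hbc hbd hab hcd h
  · have := rayCross_identity_of_lt hXY hdis.symm had.symm hbd.symm hcd hab h
    have h1 := below_add_below hac
    have h2 := below_add_below had
    have h3 := below_add_below hbc
    have h4 := below_add_below hbd
    have h5 := two_zmod (below Y c a)
    have h6 := two_zmod (below Y d a)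
    have h7 := two_zmod (below Y c b)
    have h8 := two_zmod (below Y d b)
    have h9 : (1 : ZMod 2) + 1 = 0 := two_zmod 1
    linear_combination this + h1 + h2 + h3 + h4 - h5 - h6 - h7 - h8 + 2 * h9

end Parity

namespace SimpleGraph

variable {V : Type} {E : Type*} [AddCommGroup E] [Module ℝ E]

/-- A drawing of `H` in which the edge `uv` is drawn as two segments meeting at `mid u v`, such that
vertex-disjoint edges are disjoint. -/
structure BentDrawing (H : SimpleGraph V) (pos : V → E) (mid : V → V → E) : Prop where
  symm : ∀ u v, mid u v = mid v u
  disjoint : ∀ u v x y, H.Adj u v → H.Adj x y → u ≠ x → u ≠ y → v ≠ x → v ≠ y →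
    Disjoint (segment ℝ (pos u) (mid u v)) (segment ℝ (pos x) (mid x y))

/-- Parity of the number of crossings of a horizontal ray with a drawn walk. -/
noncomputable def walkCross (X Y : E →ₗ[ℝ] ℝ) (pos : V → E) (mid : V → V → E)
    {H : SimpleGraph V} (c : E) : ∀ {u v : V}, H.Walk u v → ZMod 2
  | _, _, .nil => 0
  | u, _, .cons (v := w) _ p => rayCross X Y (pos u) (mid u w) c +
      rayCross X Y (mid u w) (pos w) c + walkCross X Y pos mid c p

variable {H : SimpleGraph V} {X Y : E →ₗ[ℝ] ℝ} {pos : V → E} {mid : V → V → E}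

theorem walkCross_segment_identity (hXY : ∀ p q, X p = X q → Y p = Y q → p = q)
    (hsymm : ∀ u v, mid u v = mid v u) {c d : E} {u v : V} (p : H.Walk u v)
    (hp : ∀ x ∈ p.support, ∀ y ∈ p.support, H.Adj x y →
      Disjoint (segment ℝ (pos x) (mid x y)) (segment ℝ c d) ∧
      Y (pos x) ≠ Y c ∧ Y (pos x) ≠ Y d ∧ Y (mid x y) ≠ Y c ∧ Y (mid x y) ≠ Y d) :
    walkCross X Y pos mid c p + walkCross X Y pos mid d p + rayCross X Y c d (pos u) +
        rayCross X Y c d (pos v) =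
      below Y c (pos u) + below Y d (pos u) + below Y c (pos v) + below Y d (pos v) := by
  induction p with
  | @nil u =>
    simp only [walkCross]
    linear_combination two_zmod (rayCross X Y c d (pos u)) - two_zmod (below Y c (pos u)) -
      two_zmod (below Y d (pos u))
  | @cons u w v h p ih =>
    have ih := ih fun x hx y hy => hp x (by simp [hx]) y (by simp [hy])
    obtain ⟨h1, h2, h3, h4, h5⟩ := hp u (by simp) w (by simp) h
    obtain ⟨k1, k2, k3, k4, k5⟩ := hp w (by simp) u (by simp) h.symm
    rw [hsymm w u] at k1 k4 k5
    have e1 := rayCross_identity hXY h1 h2 h3 h4 h5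
    have e2 := rayCross_identity hXY (by rwa [segment_symm] at k1) k4 k5 k2 k3
    simp only [walkCross]
    linear_combination e1 + e2 + ih - two_zmod (rayCross X Y c d (mid u w)) -
      two_zmod (rayCross X Y c d (pos w)) + two_zmod (below Y c (mid u w)) +
      two_zmod (below Y d (mid u w)) + two_zmod (below Y c (pos w)) + two_zmod (below Y d (pos w))

theorem BentDrawing.walkCross_identity (hD : H.BentDrawing pos mid)
    (hXY : ∀ p q, X p = X q → Y p = Y q → p = q)
    (hY : ∀ p ∈ range pos ∪ range (Function.uncurry mid),
      ∀ q ∈ range pos ∪ range (Function.uncurry mid), Y p = Y q → p = q)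
    {u v x y : V} (p : H.Walk u v) (p' : H.Walk x y)
    (hpp : ∀ a ∈ p.support, ∀ b ∈ p'.support, a ≠ b) :
    walkCross X Y pos mid (pos x) p + walkCross X Y pos mid (pos y) p +
        walkCross X Y pos mid (pos u) p' + walkCross X Y pos mid (pos v) p' =
      below Y (pos x) (pos u) + below Y (pos y) (pos u) + below Y (pos x) (pos v) +
        below Y (pos y) (pos v) := by
  have hYpos : ∀ a b, pos a ≠ pos b → Y (pos a) ≠ Y (pos b) := fun a b hab h =>
    hab (hY _ (Or.inl ⟨a, rfl⟩) _ (Or.inl ⟨b, rfl⟩) h)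
  have hYpm : ∀ a b b', pos a ≠ mid b b' → Y (pos a) ≠ Y (mid b b') := fun a b b' hab h =>
    hab (hY _ (Or.inl ⟨a, rfl⟩) _ (Or.inr ⟨(b, b'), rfl⟩) h)
  have hYmm : ∀ a a' b b', mid a a' ≠ mid b b' → Y (mid a a') ≠ Y (mid b b') :=
    fun a a' b b' hab h => hab (hY _ (Or.inr ⟨(a, a'), rfl⟩) _ (Or.inr ⟨(b, b'), rfl⟩) h)
  induction p' with
  | @nil x =>
    simp only [walkCross]
    linear_combination two_zmod (walkCross X Y pos mid (pos x) p) -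
      two_zmod (below Y (pos x) (pos u)) - two_zmod (below Y (pos x) (pos v))
  | @cons x z y h p' ih =>
    have ih := ih fun a ha b hb => hpp a ha b (by simp [hb])
    have hseg : ∀ x' z', H.Adj x' z' → (∀ a ∈ p.support, a ≠ x') → (∀ a ∈ p.support, a ≠ z') →
        ∀ a ∈ p.support, ∀ b ∈ p.support, H.Adj a b →
          Disjoint (segment ℝ (pos a) (mid a b)) (segment ℝ (pos x') (mid x' z')) ∧
          Y (pos a) ≠ Y (pos x') ∧ Y (pos a) ≠ Y (mid x' z') ∧ Y (mid a b) ≠ Y (pos x') ∧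
          Y (mid a b) ≠ Y (mid x' z') := by
      intro x' z' hxz hx hz a ha b hb hab
      have hdis := hD.disjoint a b x' z' hab hxz (hx a ha) (hz a ha) (hx b hb) (hz b hb)
      have l1 := left_mem_segment ℝ (pos a) (mid a b)
      have l2 := right_mem_segment ℝ (pos a) (mid a b)
      have l3 := left_mem_segment ℝ (pos x') (mid x' z')
      have l4 := right_mem_segment ℝ (pos x') (mid x' z')
      exact ⟨hdis, hYpos _ _ (hdis.ne_of_mem l1 l3), hYpm _ _ _ (hdis.ne_of_mem l1 l4),
        (hYpm _ _ _ (hdis.ne_of_mem l2 l3).symm).symm, hYmm _ _ _ _ (hdis.ne_of_mem l2 l4)⟩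
    have e1 := walkCross_segment_identity hXY hD.symm (c := pos x) (d := mid x z) p
      (hseg x z h (fun a ha => hpp a ha x (by simp)) fun a ha => hpp a ha z (by simp))
    have e2 := walkCross_segment_identity hXY hD.symm (c := mid x z) (d := pos z) p <| by
      intro a ha b hb hab
      obtain ⟨k1, k2, k3, k4, k5⟩ := hseg z x h.symm (fun a ha => hpp a ha z (by simp))
        (fun a ha => hpp a ha x (by simp)) a ha b hb hab
      rw [hD.symm z x] at k1 k3 k5
      exact ⟨by rwa [segment_symm ℝ (mid x z)], k3, k2, k5, k4⟩
    simp only [walkCross]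
    linear_combination e1 + e2 + ih - two_zmod (walkCross X Y pos mid (mid x z) p) -
      two_zmod (walkCross X Y pos mid (pos z) p) + two_zmod (below Y (mid x z) (pos u)) +
      two_zmod (below Y (mid x z) (pos v)) + two_zmod (below Y (pos z) (pos u)) +
      two_zmod (below Y (pos z) (pos v))

end SimpleGraph

namespace SimpleGraph

/-- The parity contradiction behind the nonplanarity of `K₅`. -/
theorem five_parity (f : Fin 5 → Fin 5 → Fin 5 → ZMod 2) (o : Fin 5 → Fin 5 → ZMod 2)
    (ho : ∀ i j, i ≠ j → o i j + o j i = 1)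
    (h : ∀ i j k l, i < j → k < l → i ≠ k → i ≠ l → j ≠ k → j ≠ l →
      f i j k + f i j l + f k l i + f k l j = o k i + o l i + o k j + o l j) : False := by
  have four : ∀ a b c d : Fin 5, a < b → b < c → c < d →
      f a b c + f a b d + f c d a + f c d b + (f a c b + f a c d + f b d a + f b d c) +
        (f a d b + f a d c + f b c a + f b c d) = 1 := by
    intro a b c d hab hbc hcd
    have hac := hab.trans hbc
    have had := hac.trans hcd
    have hbd := hbc.trans hcd
    have h1 := h a b c d hab hcd hac.ne had.ne hbc.ne hbd.ne
    have h2 := h a c b d hac hbd hab.ne had.ne hbc.ne' hcd.ne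
    have h3 := h a d b c had hbc hab.ne hac.ne hbd.ne' hcd.ne'
    linear_combination h1 + h2 + h3 + two_zmod (o c a) + two_zmod (o d a) + two_zmod (o b a) +
      ho c b hbc.ne' + ho d b hbd.ne' + ho d c hcd.ne' + two_zmod 1
  have e1 := four 0 1 2 3 (by decide) (by decide) (by decide)
  have e2 := four 0 1 2 4 (by decide) (by decide) (by decide)
  have e3 := four 0 1 3 4 (by decide) (by decide) (by decide)
  have e4 := four 0 2 3 4 (by decide) (by decide) (by decide)
  have e5 := four 1 2 3 4 (by decide) (by decide) (by decide)
  have h2 : (2 : ZMod 2) = 0 := by decide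
  have : (1 : ZMod 2) = 0 := by
    linear_combination (norm := (ring_nf; reduce_mod_char)) e1 + e2 + e3 + e4 + e5
  exact absurd this (by decide)

theorem exists_injOn_height {P : Set Plane} (hP : P.Finite) :
    ∃ s : ℝ, ∀ p ∈ P, ∀ q ∈ P, p 1 + s * p 0 = q 1 + s * q 0 → p = q := by
  obtain ⟨s, hs⟩ := ((hP.prod hP).image fun x : Plane × Plane =>
    -(x.1 1 - x.2 1) / (x.1 0 - x.2 0)).exists_notMem
  refine ⟨s, fun p hp q hq h => ?_⟩
  by_cases h0 : p 0 = q 0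
  · ext i
    fin_cases i
    · exact h0
    · rw [h0] at h
      exact add_right_cancel h
  · refine absurd ⟨(p, q), ⟨hp, hq⟩, ?_⟩ hs
    rw [div_eq_iff (sub_ne_zero.2 h0)]
    simp only
    linarith

theorem BentDrawing.noFiveTouching {V : Type} [Finite V] {H : SimpleGraph V} {pos : V → Plane}
    {mid : V → V → Plane} (hD : H.BentDrawing pos mid) : H.NoFiveTouching := by
  intro T hT hdis htouch
  obtain ⟨s, hs⟩ := exists_injOn_height
    ((finite_range pos).union (finite_range (Function.uncurry mid)))
  let X : Plane →ₗ[ℝ] ℝ := (EuclideanSpace.proj (𝕜 := ℝ) (0 : Fin 2)).toLinearMap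
  let Y : Plane →ₗ[ℝ] ℝ := (EuclideanSpace.proj (𝕜 := ℝ) (1 : Fin 2)).toLinearMap + s • X
  have hX : ∀ p, X p = p 0 := fun p => rfl
  have hY : ∀ p, Y p = p 1 + s * p 0 := fun p => rfl
  have hXY : ∀ p q, X p = X q → Y p = Y q → p = q := by
    intro p q h1 h2
    rw [hX, hX] at h1
    rw [hY, hY, h1] at h2
    ext i
    fin_cases i
    exacts [h1, add_right_cancel h2]
  have hinj : ∀ p ∈ range pos ∪ range (Function.uncurry mid),
      ∀ q ∈ range pos ∪ range (Function.uncurry mid), Y p = Y q → p = q := by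
    intro p hp q hq h
    rw [hY, hY] at h
    exact hs p hp q hq h
  choose v hv using fun i => (hT i).1
  have hconn : ∀ i j, i ≠ j → H.ConnOn (T i ∪ T j) := by
    intro i j hij
    obtain ⟨a, ha, b, hb, hab⟩ := htouch i j hij
    exact (hT i).union_of_adj (hT j) ha hb hab
  have hwalk : ∀ i j, i ≠ j → ∃ p : H.Walk (v i) (v j), ∀ x ∈ p.support, x ∈ T i ∪ T j :=
    fun i j hij => (hconn i j hij).exists_walk (Or.inl (hv i)) (Or.inr (hv j))
  choose W hW using hwalk
  have hTT : ∀ {i j k l}, i ≠ k → i ≠ l → j ≠ k → j ≠ l → ∀ a ∈ T i ∪ T j, ∀ b ∈ T k ∪ T l,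
      a ≠ b := by
    rintro i j k l h1 h2 h3 h4 a (ha | ha) b (hb | hb)
    exacts [(hdis _ _ h1).ne_of_mem ha hb, (hdis _ _ h2).ne_of_mem ha hb,
      (hdis _ _ h3).ne_of_mem ha hb, (hdis _ _ h4).ne_of_mem ha hb]
  have hkl : ∀ i j : Fin 5, i ≠ j →
      ∃ k l : Fin 5, i ≠ k ∧ j ≠ l ∧ i ≠ l ∧ j ≠ k ∧ k ≠ l := by decide
  have hpos : ∀ i j, i ≠ j → Y (pos (v i)) ≠ Y (pos (v j)) := by
    intro i j hij h
    obtain ⟨k, l, h1, h2, h3, h4, h5⟩ := hkl i j hij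
    have hvne : ∀ i j, i ≠ j → v i ≠ v j := fun i j hij => (hdis _ _ hij).ne_of_mem (hv i) (hv j)
    obtain ⟨x, hx, hvx⟩ := (hconn i k h1).exists_adj (Or.inl (hv i)) (Or.inr (hv k)) (hvne _ _ h1)
    obtain ⟨y, hy, hvy⟩ := (hconn j l h2).exists_adj (Or.inl (hv j)) (Or.inr (hv l)) (hvne _ _ h2)
    have hne := hTT hij h3 h4.symm h5
    have hdd := hD.disjoint _ _ _ _ hvx hvy (hvne _ _ hij) (hne _ (Or.inl (hv i)) _ hy)
      (hne _ hx _ (Or.inl (hv j))) (hne _ hx _ hy)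
    exact hdd.ne_of_mem (left_mem_segment ℝ _ _) (left_mem_segment ℝ _ _)
      (hinj _ (Or.inl ⟨_, rfl⟩) _ (Or.inl ⟨_, rfl⟩) h)
  refine five_parity
    (fun i j k => if h : i ≠ j then walkCross X Y pos mid (pos (v k)) (W i j h) else 0)
    (fun i j => below Y (pos (v i)) (pos (v j))) (fun i j hij => below_add_below (hpos i j hij)) ?_
  intro i j k l hij hkl h1 h2 h3 h4
  simp only [ne_eq, hij.ne, hkl.ne, not_false_eq_true, dif_pos]
  exact hD.walkCross_identity hXY hinj (W i j hij.ne) (W k l hkl.ne)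
    fun a ha b hb => hTT h1 h2 h3 h4 a (hW _ _ _ a ha) b (hW _ _ _ b hb)

end SimpleGraph

namespace Voronoi

variable {V : Type} {c : V → Plane} {p m : Plane} {u v w : V}

/-- The sites closest to `p`. -/
def nearest (c : V → Plane) (p : Plane) : Set V := {u | ∀ w, dist p (c u) ≤ dist p (c w)}

theorem mem_nearest_self : w ∈ nearest c (c u) ↔ c w = c u := by
  refine ⟨fun h => ?_, fun h x => ?_⟩
  · have := h u
    rw [_root_.dist_self, _root_.dist_le_zero] at this
    exact this.symm
  · rw [h, _root_.dist_self]
    exact _root_.dist_nonneg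

theorem dist_sq_sub_dist_sq (a b x y : Plane) (t : ℝ) :
    dist ((1 - t) • a + t • b) y ^ 2 - dist ((1 - t) • a + t • b) x ^ 2 =
      (1 - t) * (dist a y ^ 2 - dist a x ^ 2) + t * (dist b y ^ 2 - dist b x ^ 2) := by
  have h : ∀ p q : Plane, dist p q ^ 2 = (p 0 - q 0) ^ 2 + (p 1 - q 1) ^ 2 := fun p q => by
    rw [EuclideanSpace.dist_eq, Real.sq_sqrt (Finset.sum_nonneg fun _ _ => sq_nonneg _),
      Fin.sum_univ_two, Real.dist_eq, Real.dist_eq, sq_abs, sq_abs]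
  simp only [h, PiLp.add_apply, PiLp.smul_apply, smul_eq_mul]
  ring

theorem eventually_nearest_subset [Finite V] (c : V → Plane) (p : Plane) :
    ∀ᶠ q in nhds p, nearest c q ⊆ nearest c p := by
  have : ∀ w, ∀ᶠ q in nhds p, w ∈ nearest c q → w ∈ nearest c p := by
    intro w
    by_cases hw : w ∈ nearest c p
    · exact .of_forall fun _ _ => hw
    · simp only [nearest, mem_ofPred_eq, not_forall, not_le] at hw
      obtain ⟨u, hu⟩ := hw
      have : ∀ᶠ q in nhds p, Dist.dist q (c u) < Dist.dist q (c w) :=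
        (continuous_id.dist continuous_const).continuousAt.eventually_lt
          (continuous_id.dist continuous_const).continuousAt hu
      filter_upwards [this] with q hq h
      exact absurd (h u) hq.not_ge
  filter_upwards [Filter.eventually_all.2 this] with q hq w using hq w

variable [LinearOrder V]

theorem exists_isLeast_nearest [Finite V] [Nonempty V] (c : V → Plane) (p : Plane) :
    ∃ u, IsLeast (nearest c p) u := by
  obtain ⟨a, ha⟩ := Finite.exists_min fun w => dist p (c w)
  obtain ⟨u, hu, h⟩ := exists_min_image (nearest c p) id (toFinite _) ⟨a, ha⟩
  exact ⟨u, hu, h⟩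

theorem isLeast_nearest_self (h : IsLeast (nearest c p) u) : IsLeast (nearest c (c u)) u :=
  ⟨mem_nearest_self.2 rfl, fun w hw => h.2 fun x => by
    rw [mem_nearest_self.1 hw]
    exact h.1 x⟩

theorem isLeast_nearest_of_lt (hm : u ∈ nearest c m) (hu : IsLeast (nearest c (c u)) u) {t : ℝ}
    (ht₀ : 0 ≤ t) (ht₁ : t < 1) : IsLeast (nearest c ((1 - t) • c u + t • m)) u := by
  have key := fun w => dist_sq_sub_dist_sq (c u) m (c u) (c w) t
  have hmw : ∀ w, 0 ≤ dist m (c w) ^ 2 - dist m (c u) ^ 2 := fun w =>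
    sub_nonneg.2 (pow_le_pow_left₀ _root_.dist_nonneg (hm w) 2)
  refine ⟨fun w => ?_, fun w hw => hu.2 (mem_nearest_self.2 ?_)⟩
  · have h1 := mul_nonneg ht₀ (hmw w)
    have h2 := mul_nonneg (sub_nonneg.2 ht₁.le) (sq_nonneg (dist (c u) (c w)))
    refine le_of_sq_le_sq ?_ _root_.dist_nonneg
    have := key w
    rw [_root_.dist_self] at this
    linarith
  · have h1 := mul_nonneg ht₀ (hmw w)
    have h3 := pow_le_pow_left₀ _root_.dist_nonneg (hw u) 2
    have h4 := key w
    rw [_root_.dist_self] at h4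
    have h5 : dist (c u) (c w) ^ 2 ≤ 0 := by
      by_contra! h
      have := mul_pos (sub_pos.2 ht₁) h
      linarith
    have := pow_eq_zero_iff (two_ne_zero) |>.1 (le_antisymm h5 (sq_nonneg _))
    exact (_root_.dist_eq_zero.1 this).symm

/-- All elements of `e` are closest to `m`, and one of them is the least site closest to `m`. -/
def IsContact (c : V → Plane) (e : Set V) (m : Plane) : Prop :=
  e ⊆ nearest c m ∧ ∃ x ∈ e, IsLeast (nearest c m) x

/-- The edges of `G` between sites whose cells in the Voronoi diagram of `c` touch, where ties are
broken by the linear order. -/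
def spanner (G : SimpleGraph V) (c : V → Plane) : SimpleGraph V where
  Adj u v := G.Adj u v ∧ IsLeast (nearest c (c u)) u ∧ IsLeast (nearest c (c v)) v ∧
    ∃ m, IsContact c {u, v} m
  symm := ⟨fun u v ⟨h, hu, hv, hm⟩ => ⟨h.symm, hv, hu, by rwa [pair_comm]⟩⟩
  loopless := ⟨fun _ h => h.1.ne rfl⟩

theorem spanner_le (G : SimpleGraph V) (c : V → Plane) : spanner G c ≤ G :=
  fun _ _ h => h.1

theorem exists_isLeast_nearest_of_mem_segment {G : SimpleGraph V}
    (h : (spanner G c).Adj u v) (hm : IsContact c {u, v} m) (hp : p ∈ segment ℝ (c u) m) :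
    ∃ x, (x = u ∨ x = v) ∧ IsLeast (nearest c p) x := by
  obtain ⟨s, t, hs, ht, hst, rfl⟩ := hp
  obtain rfl : s = 1 - t := by linarith
  rcases eq_or_ne t 1 with rfl | ht1
  · obtain ⟨x, hx, hx'⟩ := hm.2
    exact ⟨x, hx, by simpa using hx'⟩
  · exact ⟨u, Or.inl rfl, isLeast_nearest_of_lt (hm.1 (mem_insert _ _)) h.2.1 ht
      (lt_of_le_of_ne (by linarith) ht1)⟩

theorem bentDrawing_spanner (G : SimpleGraph V) (c : V → Plane) :
    (spanner G c).BentDrawing c fun u v => Classical.epsilon (IsContact c {u, v}) where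
  symm u v := by rw [pair_comm]
  disjoint u v x y huv hxy h1 h2 h3 h4 := by
    refine disjoint_left.2 fun p hp hp' => ?_
    obtain ⟨a, ha, hap⟩ :=
      exists_isLeast_nearest_of_mem_segment huv (Classical.epsilon_spec huv.2.2.2) hp
    obtain ⟨b, hb, hbp⟩ :=
      exists_isLeast_nearest_of_mem_segment hxy (Classical.epsilon_spec hxy.2.2.2) hp'
    have := hap.unique hbp
    aesop

theorem noFiveTouching_spanner [Finite V] (G : SimpleGraph V) (c : V → Plane) :
    (spanner G c).NoFiveTouching :=
  (bentDrawing_spanner G c).noFiveTouching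

/-- A set of sites that is closed under edges of the spanner avoiding `S` contains the
representatives of both ends of an edge of `G` or of none, if `S` is far from the edge. -/
theorem mem_iff_mem_of_adj [Finite V] {G : SimpleGraph V} (hG : IsUnitDiskRealization G c)
    {f : Plane → V} (hf : ∀ p, IsLeast (nearest c p) (f p)) {D S : Set V}
    (hD : ∀ a ∈ D, ∀ b, (spanner G c).Adj a b → b ∉ D → b ∈ S)
    (huv : G.Adj u v) (hu : u ∉ S) (huS : ∀ w, G.Adj u w → w ∉ S) :
    f (c u) ∈ D ↔ f (c v) ∈ D := by
  have huv2 := ((hG u v).1 huv).2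
  have hfS : ∀ p ∈ segment ℝ (c u) (c v), f p ∉ S := by
    intro p hp
    by_cases h : u = f p
    · rwa [← h]
    · refine huS _ ((hG _ _).2 ⟨h, ?_⟩)
      have h1 := dist_add_dist_of_mem_segment hp
      have h2 := (hf p).1 v
      have h3 := dist_triangle (c u) p (c (f p))
      linarith
  have hfd : ∀ p ∈ segment ℝ (c u) (c v), dist p (c (f p)) ≤ 1 := by
    intro p hp
    have h1 := dist_add_dist_of_mem_segment hp
    have h2 := (hf p).1 v
    have h3 := (hf p).1 u
    rw [_root_.dist_comm p (c u)] at h3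
    linarith
  have : PreconnectedSpace (segment ℝ (c u) (c v)) :=
    Subtype.preconnectedSpace (convex_segment _ _).isPreconnected
  have hloc : IsLocallyConstant fun p : segment ℝ (c u) (c v) => f p ∈ D := by
    refine IsLocallyConstant.iff_eventually_eq _ |>.2 fun ⟨p, hp⟩ => ?_
    have := continuous_subtype_val.continuousAt (x := (⟨p, hp⟩ : segment ℝ (c u) (c v)))
      |>.eventually (eventually_nearest_subset c p)
    filter_upwards [this] with q hq
    have hqp := hq (hf q).1
    by_cases hne : f p = f q
    · simp only [hne]
    · have hadj : (spanner G c).Adj (f p) (f q) := by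
        refine ⟨(hG _ _).2 ⟨hne, ?_⟩, isLeast_nearest_self (hf p), isLeast_nearest_self (hf q),
          p, ?_, f p, mem_insert _ _, hf p⟩
        · have h1 := hqp (f p)
          have h2 := hfd p hp
          have h3 := dist_triangle_left (c (f p)) (c (f q)) p
          linarith
        · exact insert_subset (hf p).1 (singleton_subset_iff.2 hqp)
      refine propext ⟨fun h => ?_, fun h => ?_⟩
      · by_contra hn
        exact hfS p hp (hD _ h _ hadj.symm hn)
      · by_contra hn
        exact hfS q q.2 (hD _ h _ hadj hn)
  exact (hloc.apply_eq_of_preconnectedSpace ⟨c u, left_mem_segment ℝ _ _⟩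
    ⟨c v, right_mem_segment ℝ _ _⟩).to_iff

end Voronoi

namespace SimpleGraph

variable {V : Type} [Finite V] {G : SimpleGraph V} {Δ : ℕ}

theorem ncard_neighbors_le (hdeg : ∀ v, (G.neighborSet v).ncard ≤ Δ) (X : Set V) :
    {y | ∃ x ∈ X, G.Adj x y}.ncard ≤ X.ncard * Δ := by
  have h := ncard_biUnion_le_mul (toFinite X).toFinset G.neighborSet (z := Δ) fun v _ => hdeg v
  rw [← ncard_eq_toFinset_card X] at h
  refine le_trans (ncard_le_ncard ?_ (toFinite _)) h
  rintro y ⟨x, hx, hxy⟩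
  simp only [mem_iUnion]
  exact ⟨x, by simpa using hx, hxy⟩

theorem exists_separator_of_isUnitDiskGraph (hG : IsUnitDiskGraph G)
    (hdeg : ∀ v, (G.neighborSet v).ncard ≤ Δ) (hΔ : 2 ≤ Δ) (X : Set V) {η : ℕ} (hη : 1 ≤ η)
    (h : (G.induce Xᶜ).TreewidthLE η) :
    ∃ S : Set V, S.ncard ≤ 40 * Δ * (Δ + 1) * (η + 1) * (X.ncard.sqrt + 1) ∧
      ∀ W, G.ConnOn W → Disjoint W S → 2 * (X ∩ W).ncard ≤ X.ncard := by
  obtain ⟨c, hc⟩ := hG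
  rcases isEmpty_or_nonempty V with hV | hV
  · exact ⟨∅, by simp, fun W hW => (hV.false hW.1.some).elim⟩
  let _ : LinearOrder V := LinearOrder.lift' (Finite.equivFin V) (Finite.equivFin V).injective
  choose f hf using Voronoi.exists_isLeast_nearest c
  have hrep : ∀ x, x = f (c x) ∨ G.Adj x (f (c x)) := by
    intro x
    refine or_iff_not_imp_left.2 fun hx => (hc _ _).2 ⟨hx, ?_⟩
    rw [Voronoi.mem_nearest_self.1 (hf (c x)).1, _root_.dist_self]
    exact zero_le_two
  set H := Voronoi.spanner G c with hH
  have hHG : H ≤ G := Voronoi.spanner_le G c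
  set Y : Set V := {y | ∃ x ∈ X, G.Adj x y} \ X with hY
  have hYcard : Y.ncard ≤ X.ncard * Δ :=
    (ncard_le_ncard sdiff_subset (toFinite _)).trans (ncard_neighbors_le hdeg X)
  obtain ⟨M, hXM, hYM, hMcard, hM⟩ := exists_modulator H X
    (h.comap id Function.injective_id fun u w huw => hHG huw) Y disjoint_sdiff_left
    fun x hx y hxy => by
      by_cases hy : y ∈ X
      exacts [Or.inl hy, Or.inr ⟨⟨x, hx, hHG hxy⟩, hy⟩]
  set s := X.ncard.sqrt + 1 with hs
  have hXs : X.ncard ≤ s * s := (Nat.lt_succ_sqrt _).le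
  obtain ⟨S, hS, hSW⟩ := (Voronoi.noFiveTouching_spanner G c).exists_separator
    (M := M) (Big := fun W => X.ncard < 2 * {x | x ∈ X ∧ f (c x) ∈ W}.ncard)
    (q := 2 * (η + 1)) (N := s) (z := 5 * Δ * (η + 1) * s)
    (fun A B hAB hA => hA.trans_le (Nat.mul_le_mul_left _
      (ncard_le_ncard (fun x hx => ⟨hx.1, hAB hx.2⟩) (toFinite _))))
    (by
      intro A B hA hB
      by_contra hAB
      have hdis : Disjoint {x | x ∈ X ∧ f (c x) ∈ A} {x | x ∈ X ∧ f (c x) ∈ B} :=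
        Set.disjoint_left.2 fun x hx hx' => hAB ⟨_, hx.2, hx'.2⟩
      have h1 := ncard_union_eq hdis (toFinite _) (toFinite _)
      have h2 : ({x | x ∈ X ∧ f (c x) ∈ A} ∪ {x | x ∈ X ∧ f (c x) ∈ B}).ncard ≤ X.ncard :=
        ncard_le_ncard (union_subset (fun x hx => hx.1) fun x hx => hx.1) (toFinite _)
      lia)
    (by
      intro A hA
      obtain ⟨x, hx, hxA⟩ : {x | x ∈ X ∧ f (c x) ∈ A}.Nonempty :=
        nonempty_of_ncard_ne_zero (by lia)
      refine ⟨_, hxA, ?_⟩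
      by_cases hxX : f (c x) ∈ X
      · exact hXM hxX
      · refine hYM ⟨⟨x, hx, (hrep x).resolve_left fun h => hxX (h ▸ hx)⟩, hxX⟩)
    hM (Nat.succ_pos _)
    (by
      have h1 := Nat.mul_le_mul_left (2 * (η + 1)) hYcard
      have h2 := Nat.mul_le_mul_left (5 * Δ * (η + 1)) hXs
      have h3 : X.ncard ≤ X.ncard * (Δ * (η + 1)) := Nat.le_mul_of_pos_right _ (by positivity)
      nlinarith)
    (by
      have h1 := Nat.mul_le_mul_right ((η + 1) * s) (Nat.mul_le_mul_left 5 hΔ)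
      have h2 := Nat.mul_le_mul_right s hη
      linarith)
  refine ⟨S ∪ {y | ∃ x ∈ S, G.Adj x y}, ?_, fun W hW hWS => ?_⟩
  · have h1 := ncard_union_le S {y | ∃ x ∈ S, G.Adj x y}
    have h2 := ncard_neighbors_le hdeg S
    have h3 := Nat.mul_le_mul_right (Δ + 1) hS
    linarith
  · have hWS' : ∀ w ∈ W, w ∉ S ∧ ∀ x, G.Adj w x → x ∉ S := fun w hw =>
      ⟨fun h => Set.disjoint_left.1 hWS hw (Or.inl h),
        fun x hwx h => Set.disjoint_left.1 hWS hw (Or.inr ⟨x, h, hwx.symm⟩)⟩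
    obtain ⟨t, ht⟩ := hW.1
    have htS : f (c t) ∉ S := by
      rcases hrep t with h | h
      · rw [← h]
        exact (hWS' t ht).1
      · exact (hWS' t ht).2 _ h
    obtain ⟨D, htD, hD, hDS, hDexit⟩ :=
      (ConnOn.singleton H (f (c t))).exists_maximal (disjoint_singleton_left.2 htS)
    have hWD : W ⊆ {w | f (c w) ∈ D} := hW.2 _ ⟨t, htD rfl, ht⟩ fun a ha b hb hab =>
      (Voronoi.mem_iff_mem_of_adj hc hf hDexit hab (hWS' a ha.2).1 (hWS' a ha.2).2).1 ha.1
    have h1 := hSW D hD hDS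
    have h2 : (X ∩ W).ncard ≤ {x | x ∈ X ∧ f (c x) ∈ D}.ncard :=
      ncard_le_ncard (fun x hx => ⟨hx.1, hWD hx.2⟩) (toFinite _)
    lia

theorem exists_treewidthLE_of_isUnitDiskGraph (hΔ : 2 ≤ Δ) {η : ℕ} (hη : 1 ≤ η) (k : ℕ) :
    ∀ (V : Type) [Finite V] (G : SimpleGraph V), IsUnitDiskGraph G →
      (∀ v, (G.neighborSet v).ncard ≤ Δ) → ∀ X : Set V, X.ncard ≤ k →
        (G.induce Xᶜ).TreewidthLE η →
          G.TreewidthLE (η + ⌊200 * (Δ : ℝ) ^ 3 * (η + 1) * √k⌋₊) := by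
  induction k using Nat.strong_induction_on with
  | _ k ih =>
  intro V _ G hG hdeg X hX h
  obtain ⟨e, he⟩ : ∃ e : ℕ, e = η + 1 := ⟨_, rfl⟩
  have heR : (η : ℝ) + 1 = e := by rw [he]; push_cast; rfl
  have hpos : (1 : ℝ) ≤ Δ ^ 3 * e := by
    have : 1 ≤ Δ ^ 3 * e := Nat.mul_pos (Nat.pow_pos (by lia)) (by lia)
    exact_mod_cast this
  rw [heR]
  rcases Nat.lt_or_ge k 2 with hk | hk
  · refine (h.of_induce_compl (toFinite X) hX).mono (Nat.add_le_add_left (Nat.le_floor ?_) _)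
    have hk' : (k : ℝ) ≤ √k := by interval_cases k <;> simp
    nlinarith [Real.sqrt_nonneg (k : ℝ)]
  · obtain ⟨S, hS, hSW⟩ := exists_separator_of_isUnitDiskGraph hG hdeg hΔ X hη h
    have hconn : (G.induce Sᶜ).TreewidthLE
        (η + ⌊200 * (Δ : ℝ) ^ 3 * (η + 1) * √((k / 2 : ℕ) : ℝ)⌋₊) := by
      refine TreewidthLE.of_forall_connOn _ _ _ rfl fun W hW => ?_
      have hW' := hSW _ hW.image_induce (Set.disjoint_left.2 (by
        rintro _ ⟨x, -, rfl⟩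
        exact x.2))
      let g : W → V := fun x => x.1.1
      have hg : g.Injective := Subtype.val_injective.comp Subtype.val_injective
      refine ih (k / 2) (by lia) W _ ?_ ?_ (g ⁻¹' X) ?_ ?_
      · obtain ⟨c, hc⟩ := hG
        refine ⟨c ∘ g, fun u v => ?_⟩
        have := hc (g u) (g v)
        rw [hg.ne_iff] at this
        exact this
      · intro v
        rw [← ncard_image_of_injective _ hg]
        refine (ncard_le_ncard ?_ (toFinite _)).trans (hdeg (g v))
        rintro _ ⟨x, hx, rfl⟩
        exact hx
      · rw [← ncard_image_of_injective _ hg]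
        have : (g '' (g ⁻¹' X)).ncard ≤ (X ∩ (↑) '' W).ncard := by
          refine ncard_le_ncard ?_ (toFinite _)
          rintro _ ⟨x, hx, rfl⟩
          exact ⟨hx, x.1, x.2, rfl⟩
        lia
      · exact h.comap (fun x => ⟨g x.1, x.2⟩)
          (fun x y hxy => Subtype.ext (hg (congrArg (Subtype.val : (Xᶜ : Set V) → V) hxy)))
          fun u w huw => huw
    refine (hconn.of_induce_compl (toFinite S) le_rfl).mono ?_
    rw [add_assoc]
    refine Nat.add_le_add_left (Nat.le_floor ?_) _
    rw [Nat.cast_add, heR]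
    set A : ℝ := Δ ^ 3 * e with hA
    have hfl : (⌊200 * (Δ : ℝ) ^ 3 * e * √((k / 2 : ℕ) : ℝ)⌋₊ : ℝ) ≤ 200 * A * √(k / 2) := by
      refine (Nat.floor_le (by positivity)).trans ?_
      rw [hA, mul_assoc 200]
      refine mul_le_mul_of_nonneg_left (Real.sqrt_le_sqrt ?_) (by positivity)
      exact Nat.cast_div_le
    have hk2 : (2 : ℝ) ≤ k := by exact_mod_cast hk
    have hsq : √(k / 2 : ℝ) ≤ 0.7072 * √k := by
      refine Real.sqrt_le_iff.2 ⟨by positivity, ?_⟩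
      rw [mul_pow, Real.sq_sqrt (by positivity)]
      linarith
    have hS1 : (1.414 : ℝ) ≤ √k := Real.le_sqrt_of_sq_le (by linarith)
    have hS' : (S.ncard : ℝ) ≤ 30 * A * (√k + 1) := by
      have h1 : S.ncard ≤ 30 * (Δ ^ 3 * e) * (k.sqrt + 1) := by
        have h2 : X.ncard.sqrt + 1 ≤ k.sqrt + 1 := Nat.succ_le_succ (Nat.sqrt_le_sqrt hX)
        have h3 : 40 * Δ * (Δ + 1) * (η + 1) ≤ 30 * (Δ ^ 3 * e) := by
          rw [← he, ← mul_assoc]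
          refine Nat.mul_le_mul_right e ?_
          nlinarith [Nat.mul_le_mul_left (Δ * Δ) hΔ, Nat.mul_le_mul_left Δ hΔ]
        exact hS.trans (Nat.mul_le_mul h3 h2)
      have h2 : (S.ncard : ℝ) ≤ 30 * A * (k.sqrt + 1) := by rw [hA]; exact_mod_cast h1
      refine h2.trans (mul_le_mul_of_nonneg_left ?_ (by positivity))
      linarith [Real.nat_sqrt_le_real_sqrt (a := k)]
    have h4 : A * √(k / 2) ≤ A * (0.7072 * √k) := mul_le_mul_of_nonneg_left hsq (by linarith)
    have h5 : A * 1.414 ≤ A * √k := mul_le_mul_of_nonneg_left hS1 (by linarith)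
    rw [mul_assoc 200 ((Δ : ℝ) ^ 3) (e : ℝ), ← hA] at hfl ⊢
    nlinarith

theorem treewidth_le_of_isUnitDiskGraph {η : ℕ} (hη : 0 < η) {V : Type} [Finite V]
    {G : SimpleGraph V} (hG : IsUnitDiskGraph G) (hdeg : ∀ v, (G.neighborSet v).ncard ≤ Δ)
    (X : Set V) (hX : (G.induce Xᶜ).treewidth ≤ η) :
    (G.treewidth : ℝ) ≤ η + 200 * (Δ : ℝ) ^ 3 * (η + 1) * (X.ncard : ℝ) ^ ((1 : ℝ) / 2) := by
  rw [← Real.sqrt_eq_rpow]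
  rcases Nat.lt_or_ge Δ 2 with hΔ | hΔ
  · have h : G.TreewidthLE η := by
      refine TreewidthLE.of_forall_connOn _ _ _ rfl fun W hW => TreewidthLE.of_card ?_
      obtain ⟨t, ht⟩ := hW.1
      have hWt : W ⊆ insert t (G.neighborSet t) := by
        refine hW.2 _ ⟨t, mem_insert _ _, ht⟩ ?_
        rintro a ⟨rfl | ha, -⟩ b - hab
        · exact Or.inr hab
        · exact Or.inl ((ncard_le_one (toFinite _)).1 ((hdeg a).trans (by lia)) b hab t
            (G.adj_symm ha))
      rw [Nat.card_coe_set_eq]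
      have h1 := ncard_le_ncard hWt (toFinite _)
      have h2 := ncard_insert_le t (G.neighborSet t)
      have h3 := hdeg t
      lia
    have h' : (G.treewidth : ℝ) ≤ η := by exact_mod_cast h.treewidth_le
    exact h'.trans (le_add_of_nonneg_right (by positivity))
  · have h := exists_treewidthLE_of_isUnitDiskGraph hΔ hη X.ncard V G hG hdeg X le_rfl
      ((treewidthLE_treewidth _).mono hX)
    have h' : (G.treewidth : ℝ) ≤ _ := Nat.cast_le.2 h.treewidth_le
    refine h'.trans ?_
    rw [Nat.cast_add]
    exact add_le_add_right (Nat.floor_le (by positivity)) _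

end SimpleGraph

/-- Let `C_Δ` be the class of unit disk graphs of maximum vertex
degree at most `Δ`.  Then `C_Δ` has truly sublinear treewidth with parameter
`λ = 1/2`; concretely, for every `η > 0` one may take `β = 200·Δ³·(η+1)`: for every
`G ∈ C_Δ` and `X ⊆ V(G)`, `tw(G ∖ X) ≤ η` implies `tw(G) ≤ η + β·|X|^(1/2)`. -/
theorem unitDiskGraphs_of_bounded_degree_truly_sublinear_treewidth (Δ : ℕ) :
    HasTrulySublinearTreewidth
      (fun V G => IsUnitDiskGraph G ∧ ∀ v : V, (G.neighborSet v).ncard ≤ Δ)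
      ((1 : ℝ) / 2) ∧
    ∀ η : ℕ, 0 < η →
      ∀ (V : Type) [Fintype V] (G : SimpleGraph V),
        IsUnitDiskGraph G → (∀ v : V, (G.neighborSet v).ncard ≤ Δ) →
        ∀ X : Set V, (G.induce Xᶜ).treewidth ≤ η →
          (G.treewidth : ℝ) ≤ (η : ℝ) +
            (200 * (Δ : ℝ) ^ 3 * ((η : ℝ) + 1)) * (X.ncard : ℝ) ^ ((1 : ℝ) / 2) := by
  refine ⟨fun η hη => ⟨200 * (Δ : ℝ) ^ 3 * ((η : ℝ) + 1) + 1, by positivity, ?_⟩,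
    fun η hη V _ G hG hdeg X hX => treewidth_le_of_isUnitDiskGraph hη hG hdeg X hX⟩
  intro V _ G hG X hX
  refine (treewidth_le_of_isUnitDiskGraph hη hG.1 hG.2 X hX).trans ?_
  have : 0 ≤ (X.ncard : ℝ) ^ ((1 : ℝ) / 2) := by positivity
  linarith
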